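/- For every polynomial R ∈ C[T_ij : 0 ≤ i,j ≤ N] in (N+1)² commuting indeterminates, the function (Z,Λ) ↦ R((m_ij(Z,Λ))) vanishes identically on X_N if and only if R((b̄_ij)) = 0 in End_C(V_1), where the substitution of the operators b̄_ij for the T_ij is unambiguous since the b̄_ij pairwise commute. Consequently, sending the restriction of m_ij to X_N to the operator b̄_ij defines a well-defined isomorphism of C-algebras from the algebra of restrictions to X_N of polynomials in the functions m_ij (the algebra of regular functions on the Calogero–Moser space C_N) onto the unital subalgebra of End_C(V_1) generated by the operators b̄_ij (the Bethe algebra of the Gaudin model acting on V_1). -/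

import Mathlib

open MvPolynomial

noncomputable section

abbrev Mat (N : ℕ) := Matrix (Fin N) (Fin N) ℂ

/-- `X_N = {(Z,Λ) : rank (1 + ZΛ − ΛZ) = 1}`; the Calogero–Moser space `C_N` is its
quotient by simultaneous conjugation. -/
def XN (N : ℕ) : Set (Mat N × Mat N) :=
  {p | (1 + p.1 * p.2 - p.2 * p.1).rank = 1}

/-- The Calogero–Moser universal polynomial `det((v·1 − Λ)(u·1 − Z) − 1)` as an
element of `ℂ[v][u]` (outer variable `u`, inner variable `v`). -/
def cmPoly {N : ℕ} (Z Λ : Mat N) : Polynomial (Polynomial ℂ) :=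
  Matrix.det
    (((Polynomial.C Polynomial.X : Polynomial (Polynomial ℂ)) •
        (1 : Matrix (Fin N) (Fin N) (Polynomial (Polynomial ℂ)))
        - Λ.map (fun c => Polynomial.C (Polynomial.C c))) *
      ((Polynomial.X : Polynomial (Polynomial ℂ)) •
        (1 : Matrix (Fin N) (Fin N) (Polynomial (Polynomial ℂ)))
        - Z.map (fun c => Polynomial.C (Polynomial.C c))) - 1)

/-- `m_ij(Z,Λ)`: the coefficient of `u^{N−i} v^{N−j}` in the Calogero–Moser
universal polynomial. -/
def mcoeff (N : ℕ) (i j : Fin (N + 1)) (Z Λ : Mat N) : ℂ :=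
  ((cmPoly Z Λ).coeff (N - (i : ℕ))).coeff (N - (j : ℕ))

abbrev Rzl (N : ℕ) := MvPolynomial (Fin N ⊕ Fin N) ℂ

/-- The free `ℂ[z,λ]`-module `V_1` with basis `{ε_τ : τ ∈ S_N}`, realized as
functions `S_N → ℂ[z,λ]`. -/
abbrev V1 (N : ℕ) := Equiv.Perm (Fin N) → Rzl N

/-- Componentwise multiplication operator on `V_1`. -/
def mulDiag {N : ℕ} (g : Equiv.Perm (Fin N) → Rzl N) : Module.End ℂ (V1 N) where
  toFun F := fun τ => g τ * F τ
  map_add' F G := by funext τ; simp [mul_add]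
  map_smul' c F := by funext τ; simp [Pi.smul_apply, mul_smul_comm]

/-- The shift `ε_τ ↦ ε_{στ}` on `V_1`. -/
def shiftOp {N : ℕ} (σ : Equiv.Perm (Fin N)) : Module.End ℂ (V1 N) :=
  LinearMap.funLeft ℂ (Rzl N) (fun ρ => σ⁻¹ * ρ)

/-- The action `P^B(u,v)` on `V_1` of the universal Bethe polynomial of the
`gl_N` Gaudin model. -/
def PB (N : ℕ) (u v : ℂ) : Module.End ℂ (V1 N) :=
  ((-1 : ℤ) ^ N) • ∑ σ : Equiv.Perm (Fin N), (Equiv.Perm.sign σ : ℤ) •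
    (shiftOp σ * mulDiag (fun τ => ∏ i ∈ Finset.univ.filter (fun i => σ i = i),
        (1 - ((C u : Rzl N) - X (Sum.inl (τ⁻¹ i))) * ((C v : Rzl N) - X (Sum.inr i)))))

/-- Substitution of the pairwise commuting operators `b̄_ij` into a polynomial
`R ∈ ℂ[T_ij]` (the products are taken in a fixed order, which is irrelevant when
the `b̄_ij` commute). -/
def substB (N : ℕ) (bb : Fin (N + 1) → Fin (N + 1) → Module.End ℂ (V1 N))
    (Rp : MvPolynomial (Fin (N + 1) × Fin (N + 1)) ℂ) : Module.End ℂ (V1 N) :=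
  ∑ d ∈ Rp.support, (MvPolynomial.coeff d Rp) •
    (((List.finRange (N + 1)).map (fun i =>
        (((List.finRange (N + 1)).map (fun j => bb i j ^ d (i, j))).prod))).prod)

/-- Multiplication by a function on the space of functions on `S_N`. -/
def diagOp {N : ℕ} (f : Equiv.Perm (Fin N) → ℂ) : Module.End ℂ (Equiv.Perm (Fin N) → ℂ) where
  toFun ψ := fun g => f g * ψ g
  map_add' F G := by funext g; simp [mul_add]
  map_smul' c F := by funext g; simp only [Pi.smul_apply, smul_eq_mul, RingHom.id_apply]; ring

/-- Left translation on the space of functions on `S_N`. -/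
def transOp {N : ℕ} (σ : Equiv.Perm (Fin N)) : Module.End ℂ (Equiv.Perm (Fin N) → ℂ) :=
  LinearMap.funLeft ℂ ℂ (fun g => σ⁻¹ * g)

/-- The exchange part of the rational Dunkl operator. -/
def exchOp {N : ℕ} (x : Fin N → ℂ) (i j : Fin N) : Module.End ℂ (Equiv.Perm (Fin N) → ℂ) :=
  diagOp (fun g => (x (g⁻¹ i) - x (g⁻¹ j))⁻¹) * transOp (Equiv.swap i j)

/-- The rational Dunkl operator at parameter `t = 0`. -/
def dunkl {N : ℕ} (x p : Fin N → ℂ) (h : ℂ) (i : Fin N) :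
    Module.End ℂ (Equiv.Perm (Fin N) → ℂ) :=
  diagOp (fun g => p (g⁻¹ i)) + h • ∑ j, exchOp x i j

section Dunkl
variable {N : ℕ}

@[simp] lemma diagOp_apply (f : Equiv.Perm (Fin N) → ℂ) (ψ : Equiv.Perm (Fin N) → ℂ)
    (g : Equiv.Perm (Fin N)) : diagOp f ψ g = f g * ψ g := rfl

@[simp] lemma transOp_apply (σ : Equiv.Perm (Fin N)) (ψ : Equiv.Perm (Fin N) → ℂ)
    (g : Equiv.Perm (Fin N)) : transOp σ ψ g = ψ (σ⁻¹ * g) := rfl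

@[simp] lemma exchOp_apply (x : Fin N → ℂ) (i j : Fin N) (ψ : Equiv.Perm (Fin N) → ℂ)
    (g : Equiv.Perm (Fin N)) :
    exchOp x i j ψ g = (x (g⁻¹ i) - x (g⁻¹ j))⁻¹ * ψ (Equiv.swap i j * g) := by
  simp [exchOp]

lemma dunkl_apply (x p : Fin N → ℂ) (h : ℂ) (i : Fin N) (ψ : Equiv.Perm (Fin N) → ℂ)
    (g : Equiv.Perm (Fin N)) :
    dunkl x p h i ψ g = p (g⁻¹ i) * ψ g +
      h * ∑ j, (x (g⁻¹ i) - x (g⁻¹ j))⁻¹ * ψ (Equiv.swap i j * g) := by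
  simp [dunkl, LinearMap.sum_apply, Finset.sum_apply]

lemma transOp_one : transOp (1 : Equiv.Perm (Fin N)) = 1 := by
  ext ψ g; simp

lemma transOp_mul (σ τ : Equiv.Perm (Fin N)) : transOp (σ * τ) = transOp σ * transOp τ := by
  refine LinearMap.ext fun ψ => funext fun g => ?_
  simp [mul_assoc]

lemma transOp_mul_diagOp (σ : Equiv.Perm (Fin N)) (f : Equiv.Perm (Fin N) → ℂ) :
    transOp σ * diagOp f = diagOp (fun g => f (σ⁻¹ * g)) * transOp σ := by
  refine LinearMap.ext fun ψ => funext fun g => ?_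
  simp

lemma diagOp_mul (f f' : Equiv.Perm (Fin N) → ℂ) :
    diagOp f * diagOp f' = diagOp (fun g => f g * f' g) := by
  refine LinearMap.ext fun ψ => funext fun g => ?_
  simp [mul_assoc]

lemma exchOp_self (x : Fin N → ℂ) (i : Fin N) : exchOp x i i = 0 := by
  refine LinearMap.ext fun ψ => funext fun g => ?_
  simp

lemma exchOp_symm (x : Fin N → ℂ) (i j : Fin N) : exchOp x j i = -exchOp x i j := by
  refine LinearMap.ext fun ψ => funext fun g => ?_
  simp only [exchOp_apply, LinearMap.neg_apply, Pi.neg_apply]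
  rw [Equiv.swap_comm, ← neg_sub, inv_neg, neg_mul]

lemma exchOp_comm_of_disjoint (x : Fin N → ℂ) {i j k l : Fin N} (hij : i ≠ j) (hil : i ≠ l)
    (hkj : k ≠ j) (hkl : k ≠ l) :
    exchOp x i k * exchOp x j l = exchOp x j l * exchOp x i k := by
  refine LinearMap.ext fun ψ => funext fun g => ?_
  have e : Equiv.swap j l * Equiv.swap i k = Equiv.swap i k * Equiv.swap j l :=
    (Equiv.Perm.Disjoint.commute (by
      intro a
      by_cases h1 : a = j <;> by_cases h2 : a = l <;> by_cases h3 : a = i <;>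
        by_cases h4 : a = k <;> simp_all [Equiv.swap_apply_of_ne_of_ne])).eq
  simp only [Module.End.mul_apply, exchOp_apply, mul_inv_rev, Equiv.swap_inv,
    Equiv.Perm.mul_apply, Equiv.swap_apply_of_ne_of_ne hij.symm hkj.symm,
    Equiv.swap_apply_of_ne_of_ne hil.symm hkl.symm, Equiv.swap_apply_of_ne_of_ne hij hil,
    Equiv.swap_apply_of_ne_of_ne hkj hkl, ← mul_assoc, e]
  ring

lemma exchOp_yang_baxter {x : Fin N → ℂ} (hx : Function.Injective x) {i j k : Fin N}
    (hij : i ≠ j) (hik : i ≠ k) (hjk : j ≠ k) :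
    exchOp x i k * exchOp x j k - exchOp x j k * exchOp x i k
      + (exchOp x i j * exchOp x j k - exchOp x j k * exchOp x i j)
      + (exchOp x i k * exchOp x j i - exchOp x j i * exchOp x i k) = 0 := by
  refine LinearMap.ext fun ψ => funext fun g => ?_
  have e1 : Equiv.swap j k * Equiv.swap i k = Equiv.swap j i * Equiv.swap j k := by
    rw [Equiv.mul_swap_eq_swap_mul, Equiv.swap_apply_of_ne_of_ne hij hik,
      Equiv.swap_apply_right, Equiv.swap_comm i j]
  have e2 : Equiv.swap i k * Equiv.swap j i = Equiv.swap j k * Equiv.swap i k := by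
    rw [Equiv.mul_swap_eq_swap_mul, Equiv.swap_apply_left,
      Equiv.swap_apply_of_ne_of_ne hij.symm hjk]
  have e3 : Equiv.swap i k * Equiv.swap j k = Equiv.swap j i * Equiv.swap i k := by
    rw [Equiv.mul_swap_eq_swap_mul, Equiv.swap_apply_of_ne_of_ne hij.symm hjk,
      Equiv.swap_apply_right]
  have e4 : Equiv.swap j k * Equiv.swap j i = Equiv.swap i k * Equiv.swap j k := by
    rw [Equiv.mul_swap_eq_swap_mul, Equiv.swap_apply_left,
      Equiv.swap_apply_of_ne_of_ne hij hik, Equiv.swap_comm k i]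
  have hne : ∀ a b : Fin N, a ≠ b → x (g⁻¹ a) - x (g⁻¹ b) ≠ 0 := fun a b hab =>
    sub_ne_zero.2 fun h => hab (g⁻¹.injective (hx h))
  have h1 := hne i j hij
  have h2 := hne i k hik
  have h3 := hne j k hjk
  rw [exchOp_symm x j i]
  simp only [LinearMap.add_apply, LinearMap.sub_apply, LinearMap.neg_apply, Pi.add_apply,
    Pi.sub_apply, Pi.neg_apply, mul_neg, LinearMap.zero_apply, Pi.zero_apply,
    Module.End.mul_apply, exchOp_apply, mul_inv_rev,
    Equiv.swap_inv, Equiv.Perm.mul_apply, Equiv.swap_apply_left, Equiv.swap_apply_right,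
    Equiv.swap_apply_of_ne_of_ne hij hik, Equiv.swap_apply_of_ne_of_ne hij.symm hjk,
    Equiv.swap_apply_of_ne_of_ne hjk.symm hik.symm, ← mul_assoc]
  simp only [e2, e4, e1, e3]
  have h1' : x (g⁻¹ j) - x (g⁻¹ i) ≠ 0 := hne j i hij.symm
  have h2' := hne k i hik.symm
  have h3' := hne k j hjk.symm
  generalize ψ (Equiv.swap j i * Equiv.swap j k * g) = A
  generalize ψ (Equiv.swap j i * Equiv.swap i k * g) = B
  field_simp
  ring

lemma diagOp_exchOp_comm (p x : Fin N → ℂ) {i j l : Fin N} (hij : i ≠ j) (hil : i ≠ l) :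
    diagOp (fun g => p (g⁻¹ i)) * exchOp x j l = exchOp x j l * diagOp (fun g => p (g⁻¹ i)) := by
  refine LinearMap.ext fun ψ => funext fun g => ?_
  simp only [Module.End.mul_apply, diagOp_apply, exchOp_apply, mul_inv_rev, Equiv.swap_inv,
    Equiv.Perm.mul_apply, Equiv.swap_apply_of_ne_of_ne hij hil]
  ring

lemma dunkl_commute {x : Fin N → ℂ} (hx : Function.Injective x) (p : Fin N → ℂ) (h : ℂ)
    (i j : Fin N) : dunkl x p h i * dunkl x p h j = dunkl x p h j * dunkl x p h i := by
  rcases eq_or_ne i j with rfl | hij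
  · rfl
  have hdiag : diagOp (fun g => p (g⁻¹ i)) * diagOp (fun g => p (g⁻¹ j))
      = diagOp (fun g => p (g⁻¹ j)) * diagOp (fun g => p (g⁻¹ i)) := by
    simp only [diagOp_mul, mul_comm]
  have hcross : ∀ i j : Fin N, i ≠ j →
      diagOp (fun g => p (g⁻¹ i)) * (∑ l, exchOp x j l)
        - (∑ l, exchOp x j l) * diagOp (fun g => p (g⁻¹ i))
      = diagOp (fun g => p (g⁻¹ i)) * exchOp x j i
        - exchOp x j i * diagOp (fun g => p (g⁻¹ i)) := by
    intro i j hij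
    rw [Finset.mul_sum, Finset.sum_mul, ← Finset.sum_sub_distrib]
    refine Finset.sum_eq_single i (fun l _ hl => ?_) (by simp)
    rw [diagOp_exchOp_comm p x hij hl.symm, sub_self]
  have hlin : (diagOp (fun g => p (g⁻¹ i)) * exchOp x j i
        - exchOp x j i * diagOp (fun g => p (g⁻¹ i)))
      - (diagOp (fun g => p (g⁻¹ j)) * exchOp x i j
        - exchOp x i j * diagOp (fun g => p (g⁻¹ j))) = 0 := by
    refine LinearMap.ext fun ψ => funext fun g => ?_
    rw [exchOp_symm x i j]
    simp only [LinearMap.sub_apply, Pi.sub_apply, Module.End.mul_apply, diagOp_apply,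
      exchOp_apply, mul_inv_rev, Equiv.swap_inv, Equiv.Perm.mul_apply,
      Equiv.swap_apply_left, Equiv.swap_apply_right, mul_neg, LinearMap.neg_apply,
      Pi.neg_apply, LinearMap.zero_apply, Pi.zero_apply]
    ring
  have hquad : (∑ k, exchOp x i k) * (∑ l, exchOp x j l)
      - (∑ l, exchOp x j l) * (∑ k, exchOp x i k) = 0 := by
    set B : Fin N → Fin N → Module.End ℂ (Equiv.Perm (Fin N) → ℂ) := fun k l =>
      exchOp x i k * exchOp x j l - exchOp x j l * exchOp x i k with hB
    have hBi : ∀ l, B i l = 0 := fun l => by simp [hB, exchOp_self]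
    have hBj : ∀ k, B k j = 0 := fun k => by simp [hB, exchOp_self]
    have hBji : B j i = 0 := by
      simp only [hB]; rw [exchOp_symm x i j]
      exact sub_eq_zero.2 (Commute.neg_right (Commute.refl (exchOp x i j))).eq
    have hB0 : ∀ k l, B k l = (if l = k then B k l else 0) + (if k = j then B k l else 0)
        + (if l = i then B k l else 0) := by
      intro k l
      by_cases hki : k = i
      · subst hki; simp [hBi]
      by_cases hlj : l = j
      · subst hlj; simp [hBj]
      by_cases h1 : l = k
      · subst h1
        by_cases h3 : l = i
        · exact absurd h3 hki
        · simp [h3, hlj]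
      · by_cases h2 : k = j
        · subst h2
          by_cases h3 : l = i
          · subst h3; simp [hBji]
          · simp [h1, h3]
        · by_cases h3 : l = i
          · simp [h2, h3, Ne.symm hki]
          · simp only [h1, h2, h3, if_false, add_zero]
            simp only [hB]
            rw [exchOp_comm_of_disjoint x hij (Ne.symm h3) h2 (Ne.symm h1), sub_self]
    have hsum : (∑ k, exchOp x i k) * (∑ l, exchOp x j l)
        - (∑ l, exchOp x j l) * (∑ k, exchOp x i k) = ∑ k, ∑ l, B k l := by
      rw [Finset.sum_mul_sum, Finset.sum_mul_sum, Finset.sum_comm (s := Finset.univ)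
        (f := fun l k => exchOp x j l * exchOp x i k), ← Finset.sum_sub_distrib]
      simp only [← Finset.sum_sub_distrib, hB]
    rw [hsum]
    have hS : ∑ k, ∑ l, B k l = ∑ k, (B k k + B j k + B k i) := by
      simp only [Finset.sum_add_distrib]
      rw [Finset.sum_congr rfl fun k _ => Finset.sum_congr rfl fun l _ => hB0 k l]
      simp only [Finset.sum_add_distrib, Finset.sum_ite_eq', Finset.mem_univ, if_true]
      congr 2
      rw [Finset.sum_comm]
      simp
    rw [hS]
    refine Finset.sum_eq_zero fun k _ => ?_
    by_cases hki : k = i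
    · subst hki; simp [hBi, hBji]
    by_cases hkj : k = j
    · subst hkj; simp [hBj, hBji]
    exact exchOp_yang_baxter hx hij (Ne.symm hki) (Ne.symm hkj)
  have c1 := hcross i j hij
  have c2 := hcross j i hij.symm
  rw [← sub_eq_zero]
  calc dunkl x p h i * dunkl x p h j - dunkl x p h j * dunkl x p h i
      = (diagOp (fun g => p (g⁻¹ i)) * diagOp (fun g => p (g⁻¹ j))
          - diagOp (fun g => p (g⁻¹ j)) * diagOp (fun g => p (g⁻¹ i)))
        + h • ((diagOp (fun g => p (g⁻¹ i)) * (∑ l, exchOp x j l)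
            - (∑ l, exchOp x j l) * diagOp (fun g => p (g⁻¹ i)))
          - (diagOp (fun g => p (g⁻¹ j)) * (∑ l, exchOp x i l)
            - (∑ l, exchOp x i l) * diagOp (fun g => p (g⁻¹ j))))
        + (h * h) • ((∑ k, exchOp x i k) * (∑ l, exchOp x j l)
            - (∑ l, exchOp x j l) * (∑ k, exchOp x i k)) := by
        simp only [dunkl, mul_add, add_mul, smul_mul_assoc, mul_smul_comm, smul_add, smul_sub,
          smul_smul]
        abel
    _ = 0 := by rw [c1, c2, hlin, hquad, hdiag]; simp

lemma transOp_mul_dunkl (x p : Fin N → ℂ) (h : ℂ) (σ : Equiv.Perm (Fin N)) (i : Fin N) :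
    transOp σ * dunkl x p h i = dunkl x p h (σ i) * transOp σ := by
  refine LinearMap.ext fun ψ => funext fun g => ?_
  simp only [Module.End.mul_apply, transOp_apply, dunkl_apply, mul_inv_rev, inv_inv,
    Equiv.Perm.mul_apply]
  congr 2
  refine Fintype.sum_equiv σ _ _ fun j => ?_
  congr 2
  rw [← mul_assoc, ← mul_assoc, Equiv.mul_swap_eq_swap_mul]
  simp

end Dunkl

open scoped IsMulCommutative in
/-- Substitution of a commuting family of elements of an algebra into polynomials. -/
lemma exists_algHom_of_commute {σ A : Type*} [Ring A] [Algebra ℂ A] (a : σ → A)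
    (ha : ∀ i j, a i * a j = a j * a i) :
    ∃ f : MvPolynomial σ ℂ →ₐ[ℂ] A, ∀ i, f (X i) = a i := by
  let S := Algebra.adjoin ℂ (Set.range a)
  have : IsMulCommutative S := Algebra.isMulCommutative_adjoin ℂ (by
    rintro _ ⟨i, rfl⟩ _ ⟨j, rfl⟩; exact ha i j)
  let f : MvPolynomial σ ℂ →ₐ[ℂ] S :=
    aeval fun i => (⟨a i, Algebra.subset_adjoin ⟨i, rfl⟩⟩ : S)
  exact ⟨S.val.comp f, fun i => by simp [f]⟩

section DunklEval
variable {N : ℕ}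

lemma commute_scalar_dunkl {x : Fin N → ℂ} (hx : Function.Injective x) (z p : Fin N → ℂ) (h : ℂ)
    (a b : Fin N ⊕ Fin N) :
    Commute (Sum.elim (fun i => algebraMap ℂ (Module.End ℂ (Equiv.Perm (Fin N) → ℂ)) (z i))
      (dunkl x p h) a) (Sum.elim
        (fun i => algebraMap ℂ (Module.End ℂ (Equiv.Perm (Fin N) → ℂ)) (z i)) (dunkl x p h) b) := by
  rcases a with i | i <;> rcases b with j | j
  · exact Algebra.commutes _ _
  · exact Algebra.commutes _ _
  · exact (Algebra.commutes _ _).symm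
  · exact dunkl_commute hx p h i j

/-- Substitution of scalars for the `z_i` and of Dunkl operators for the `λ_i`. -/
def dunklEval {x : Fin N → ℂ} (hx : Function.Injective x) (z p : Fin N → ℂ) (h : ℂ) :
    Rzl N →ₐ[ℂ] Module.End ℂ (Equiv.Perm (Fin N) → ℂ) :=
  (exists_algHom_of_commute _ (commute_scalar_dunkl hx z p h)).choose

variable {x : Fin N → ℂ} (hx : Function.Injective x) (z p : Fin N → ℂ) (h : ℂ)

lemma dunklEval_inl (i : Fin N) : dunklEval hx z p h (X (Sum.inl i)) = algebraMap ℂ _ (z i) :=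
  (exists_algHom_of_commute _ (commute_scalar_dunkl hx z p h)).choose_spec (Sum.inl i)

lemma dunklEval_inr (i : Fin N) : dunklEval hx z p h (X (Sum.inr i)) = dunkl x p h i :=
  (exists_algHom_of_commute _ (commute_scalar_dunkl hx z p h)).choose_spec (Sum.inr i)

lemma dunklEval_C (c : ℂ) : dunklEval hx z p h (C c) = algebraMap ℂ _ c :=
  (dunklEval hx z p h).commutes c

lemma dunklEval_sub (v : ℂ) (i : Fin N) :
    dunklEval hx z p h (C v - X (Sum.inr i)) = algebraMap ℂ _ v - dunkl x p h i := by
  rw [map_sub, dunklEval_C, dunklEval_inr]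

lemma transOp_mul_sub_dunkl (v : ℂ) (σ : Equiv.Perm (Fin N)) (i : Fin N) :
    transOp σ * (algebraMap ℂ _ v - dunkl x p h i)
      = (algebraMap ℂ _ v - dunkl x p h (σ i)) * transOp σ := by
  rw [mul_sub, sub_mul, transOp_mul_dunkl, Algebra.commutes]

lemma transOp_mul_dunklEval_prod (v : ℂ) (σ : Equiv.Perm (Fin N)) (K : Finset (Fin N)) :
    transOp σ * dunklEval hx z p h (∏ i ∈ K, (C v - X (Sum.inr i)))
      = dunklEval hx z p h (∏ i ∈ K, (C v - X (Sum.inr (σ i)))) * transOp σ := by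
  induction K using Finset.induction_on with
  | empty => simp
  | insert i K hi ih =>
    rw [Finset.prod_insert hi, Finset.prod_insert hi, map_mul, map_mul, dunklEval_sub,
      dunklEval_sub, ← mul_assoc, transOp_mul_sub_dunkl, mul_assoc, ih, mul_assoc]

lemma transOp_commute_dunklEval_prod (v : ℂ) (σ : Equiv.Perm (Fin N)) (K : Finset (Fin N))
    (hK : ∀ i ∈ K, σ i = i) :
    transOp σ * dunklEval hx z p h (∏ i ∈ K, (C v - X (Sum.inr i)))
      = dunklEval hx z p h (∏ i ∈ K, (C v - X (Sum.inr i))) * transOp σ := by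
  rw [transOp_mul_dunklEval_prod]
  congr 2
  exact Finset.prod_congr rfl fun i hi => by rw [hK i hi]

lemma exchOp_mul_diagOp (i j : Fin N) (f : Equiv.Perm (Fin N) → ℂ) :
    exchOp x i j * diagOp f = diagOp f * exchOp x i j
      + diagOp (fun g => (x (g⁻¹ i) - x (g⁻¹ j))⁻¹ * (f (Equiv.swap i j * g) - f g))
        * transOp (Equiv.swap i j) := by
  refine LinearMap.ext fun ψ => funext fun g => ?_
  simp only [Module.End.mul_apply, diagOp_apply, exchOp_apply, LinearMap.add_apply,
    Pi.add_apply, transOp_apply, Equiv.swap_inv]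
  ring

lemma dunkl_mul_diagOp (i : Fin N) (f : Equiv.Perm (Fin N) → ℂ) :
    dunkl x p h i * diagOp f = diagOp f * dunkl x p h i
      + h • ∑ j, diagOp (fun g => (x (g⁻¹ i) - x (g⁻¹ j))⁻¹ *
          (f (Equiv.swap i j * g) - f g)) * transOp (Equiv.swap i j) := by
  have e : diagOp (fun g => p (g⁻¹ i)) * diagOp f = diagOp f * diagOp (fun g => p (g⁻¹ i)) := by
    simp only [diagOp_mul, mul_comm]
  rw [dunkl, add_mul, mul_add, e, smul_mul_assoc, mul_smul_comm, Finset.sum_mul,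
    Finset.mul_sum, add_assoc, ← smul_add, ← Finset.sum_add_distrib]
  congr 2
  exact Finset.sum_congr rfl fun j _ => exchOp_mul_diagOp i j f

lemma dunkl_mul_coord_of_ne (hx : Function.Injective x) (p : Fin N → ℂ) (h : ℂ)
    {i k : Fin N} (hik : i ≠ k) :
    dunkl x p h i * diagOp (fun g => x (g⁻¹ k)) = diagOp (fun g => x (g⁻¹ k)) * dunkl x p h i
      + h • transOp (Equiv.swap i k) := by
  rw [dunkl_mul_diagOp]
  congr 2
  rw [Finset.sum_eq_single k]
  · refine LinearMap.ext fun ψ => funext fun g => ?_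
    have hne : x (g⁻¹ i) - x (g⁻¹ k) ≠ 0 :=
      sub_ne_zero.2 fun h => hik (g⁻¹.injective (hx h))
    simp only [Module.End.mul_apply, diagOp_apply, transOp_apply, mul_inv_rev, Equiv.swap_inv,
      Equiv.Perm.mul_apply, Equiv.swap_apply_right, inv_mul_cancel₀ hne, one_mul]
  · intro j _ hj
    refine LinearMap.ext fun ψ => funext fun g => ?_
    simp [Equiv.swap_apply_of_ne_of_ne hik.symm hj.symm]
  · simp

lemma dunkl_mul_coord_self (hx : Function.Injective x) (p : Fin N → ℂ) (h : ℂ) (k : Fin N) :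
    dunkl x p h k * diagOp (fun g => x (g⁻¹ k)) = diagOp (fun g => x (g⁻¹ k)) * dunkl x p h k
      - h • ∑ i ∈ Finset.univ.erase k, transOp (Equiv.swap i k) := by
  rw [dunkl_mul_diagOp, eq_sub_iff_add_eq, add_assoc, ← smul_add]
  convert add_zero _
  convert smul_zero h
  rw [← Finset.sum_erase (a := k) Finset.univ, ← Finset.sum_add_distrib]
  · refine Finset.sum_eq_zero fun i hi => ?_
    refine LinearMap.ext fun ψ => funext fun g => ?_
    have hne : x (g⁻¹ k) - x (g⁻¹ i) ≠ 0 :=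
      sub_ne_zero.2 fun h => (Finset.ne_of_mem_erase hi).symm (g⁻¹.injective (hx h))
    have hinv : (x (g⁻¹ k) - x (g⁻¹ i))⁻¹ * (x (g⁻¹ i) - x (g⁻¹ k)) = -1 := by
      rw [← neg_sub (x (g⁻¹ k)), mul_neg, inv_mul_cancel₀ hne]
    simp only [LinearMap.add_apply, Module.End.mul_apply, diagOp_apply, transOp_apply,
      mul_inv_rev, Equiv.swap_inv, Pi.add_apply, Equiv.swap_comm i k,
      Equiv.Perm.mul_apply, Equiv.swap_apply_left, hinv, LinearMap.zero_apply, Pi.zero_apply]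
    ring
  · refine LinearMap.ext fun ψ => funext fun g => ?_
    simp

lemma dunklEval_prod_mul_coord (v : ℂ) (k : Fin N) (K : Finset (Fin N)) (hk : k ∉ K) :
    dunklEval hx z p h (∏ i ∈ K, (C v - X (Sum.inr i))) * diagOp (fun g => x (g⁻¹ k))
      = diagOp (fun g => x (g⁻¹ k)) * dunklEval hx z p h (∏ i ∈ K, (C v - X (Sum.inr i)))
        - h • ∑ i ∈ K, dunklEval hx z p h (∏ l ∈ K.erase i, (C v - X (Sum.inr l))) *
            transOp (Equiv.swap i k) := by
  induction K using Finset.induction_on with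
  | empty => simp
  | insert i K hi ih =>
    have hki : i ≠ k := fun e => hk (by simp [e])
    have hkK : k ∉ K := fun e => hk (by simp [e])
    have hsum : ∑ j ∈ K, dunklEval hx z p h
          (∏ l ∈ (insert i K).erase j, (C v - X (Sum.inr l))) * transOp (Equiv.swap j k)
        = ∑ j ∈ K, (algebraMap ℂ _ v - dunkl x p h i) * (dunklEval hx z p h
          (∏ l ∈ K.erase j, (C v - X (Sum.inr l))) * transOp (Equiv.swap j k)) := by
      refine Finset.sum_congr rfl fun j hj => ?_
      have hij : i ≠ j := fun e => hi (e ▸ hj)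
      rw [Finset.erase_insert_of_ne hij, Finset.prod_insert (by simp [hi]), map_mul,
        dunklEval_sub, mul_assoc]
    have hcomm := transOp_commute_dunklEval_prod hx z p h v (Equiv.swap i k) K (fun l hl =>
      Equiv.swap_apply_of_ne_of_ne (fun e => hi (e ▸ hl)) (fun e => hkK (e ▸ hl)))
    rw [Finset.sum_insert hi, Finset.erase_insert hi, hsum, ← Finset.mul_sum,
      Finset.prod_insert hi, map_mul, dunklEval_sub, mul_assoc, ih hkK, ← hcomm]
    set Y := dunklEval hx z p h (∏ i ∈ K, (C v - X (Sum.inr i)))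
    have hd := dunkl_mul_coord_of_ne hx p h hki
    rw [mul_sub, ← mul_assoc, sub_mul (algebraMap ℂ _ v), hd, Algebra.commutes v]
    simp only [mul_smul_comm, sub_mul, mul_sub, add_mul, smul_mul_assoc, smul_add, mul_assoc,
      smul_sub]
    abel

lemma dunklEval_prod_univ_commute_coord (v : ℂ) (k : Fin N) :
    dunklEval hx z p h (∏ i, (C v - X (Sum.inr i))) * diagOp (fun g => x (g⁻¹ k))
      = diagOp (fun g => x (g⁻¹ k)) * dunklEval hx z p h (∏ i, (C v - X (Sum.inr i))) := by
  rw [← Finset.mul_prod_erase _ _ (Finset.mem_univ k), map_mul, mul_assoc,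
    dunklEval_prod_mul_coord hx z p h v k _ (Finset.notMem_erase k _), dunklEval_sub]
  have hswap : ∀ i ∈ Finset.univ.erase k,
      (algebraMap ℂ _ v - dunkl x p h k) * (dunklEval hx z p h
        (∏ l ∈ (Finset.univ.erase k).erase i, (C v - X (Sum.inr l))) * transOp (Equiv.swap i k))
      = transOp (Equiv.swap i k) *
        dunklEval hx z p h (∏ l ∈ Finset.univ.erase k, (C v - X (Sum.inr l))) := by
    intro i hi
    rw [← Finset.mul_prod_erase _ _ hi, map_mul, dunklEval_sub, ← mul_assoc, ← mul_assoc,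
      transOp_mul_sub_dunkl, Equiv.swap_apply_left, mul_assoc, mul_assoc,
      transOp_commute_dunklEval_prod]
    intro l hl
    simp only [Finset.mem_erase, Finset.mem_univ, and_true] at hl
    exact Equiv.swap_apply_of_ne_of_ne hl.1 hl.2
  rw [mul_sub, mul_smul_comm, Finset.mul_sum, Finset.sum_congr rfl hswap, ← Finset.sum_mul]
  set Y := dunklEval hx z p h (∏ l ∈ Finset.univ.erase k, (C v - X (Sum.inr l)))
  rw [← mul_assoc, sub_mul (algebraMap ℂ _ v), dunkl_mul_coord_self hx, Algebra.commutes v]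
  simp only [sub_mul, mul_sub, smul_mul_assoc, mul_assoc]
  abel

lemma dunklEval_prod_univ_scalar (v : ℂ) :
    ∃ c : ℂ, dunklEval hx z p h (∏ i, (C v - X (Sum.inr i))) = algebraMap ℂ _ c := by
  set T := dunklEval hx z p h (∏ i, (C v - X (Sum.inr i))) with hT
  have hoff : ∀ g g' : Equiv.Perm (Fin N), g' ≠ g → T (Pi.single g 1) g' = 0 := by
    intro g g' hg
    obtain ⟨k, hk⟩ : ∃ k, g'⁻¹ k ≠ g⁻¹ k := by
      by_contra! hc
      exact hg (inv_injective (Equiv.ext hc))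
    have e1 : diagOp (fun g => x (g⁻¹ k)) (Pi.single g 1) =
        x (g⁻¹ k) • (Pi.single g 1 : Equiv.Perm (Fin N) → ℂ) := by
      funext a
      rcases eq_or_ne a g with rfl | ha
      · simp
      · simp [ha]
    have e2 := congrFun (LinearMap.congr_fun (dunklEval_prod_univ_commute_coord hx z p h v k)
      (Pi.single g 1)) g'
    simp only [← hT, Module.End.mul_apply, e1, map_smul, Pi.smul_apply, smul_eq_mul,
      diagOp_apply] at e2
    have e3 : (x (g⁻¹ k) - x (g'⁻¹ k)) * T (Pi.single g 1) g' = 0 := by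
      rw [sub_mul, e2, sub_self]
    exact (mul_eq_zero.1 e3).resolve_left (sub_ne_zero.2 fun e => hk (hx e).symm)
  have htrans : ∀ σ : Equiv.Perm (Fin N), transOp σ * T = T * transOp σ := by
    intro σ
    rw [hT, transOp_mul_dunklEval_prod]
    congr 2
    exact Equiv.prod_comp σ fun i => (C v - X (Sum.inr i) : Rzl N)
  have hsingle : ∀ σ : Equiv.Perm (Fin N), transOp σ (Pi.single 1 1 : Equiv.Perm (Fin N) → ℂ)
      = Pi.single σ 1 := by
    intro σ
    funext a
    simp [Pi.single_apply, inv_mul_eq_one, eq_comm]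
  refine ⟨T (Pi.single 1 1) 1, (Pi.basisFun ℂ (Equiv.Perm (Fin N))).ext fun g => ?_⟩
  funext g'
  simp only [Pi.basisFun_apply, Module.algebraMap_end_apply, Pi.smul_apply, smul_eq_mul]
  rcases eq_or_ne g' g with rfl | hg
  · have e := congrFun (LinearMap.congr_fun (htrans g') (Pi.single 1 1)) g'
    simp only [Module.End.mul_apply, hsingle, transOp_apply, inv_mul_cancel] at e
    simp [e]
  · rw [hoff g g' hg, Pi.single_eq_of_ne hg, mul_zero]

end DunklEval

section Gram
variable {N : ℕ}

lemma trace_aeval_eq_zero_of_roots (Z : Mat N) (f : Polynomial ℂ)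
    (hf : ∀ ξ ∈ Z.charpoly.roots, f.eval ξ = 0) : (Polynomial.aeval Z f).trace = 0 := by
  have hdvd : ∀ s : Multiset ℂ, (∀ ξ ∈ s, f.eval ξ = 0) →
      (s.map fun ξ => Polynomial.X - Polynomial.C ξ).prod ∣ f ^ s.card := by
    intro s
    induction s using Multiset.induction_on with
    | empty => simp
    | cons ξ s ih =>
      intro h
      rw [Multiset.map_cons, Multiset.prod_cons, Multiset.card_cons, pow_succ']
      exact mul_dvd_mul (Polynomial.dvd_iff_isRoot.2 (h ξ (Multiset.mem_cons_self ξ s)))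
        (ih fun η hη => h η (Multiset.mem_cons_of_mem hη))
  have hnil : IsNilpotent (Polynomial.aeval Z f) := by
    refine ⟨Z.charpoly.roots.card, ?_⟩
    obtain ⟨g, hg⟩ := hdvd _ hf
    rw [← (IsAlgClosed.splits Z.charpoly).eq_prod_roots_of_monic Z.charpoly_monic] at hg
    rw [← map_pow, hg, map_mul, Matrix.aeval_self_charpoly, zero_mul]
  exact (Matrix.isNilpotent_trace_of_isNilpotent hnil).eq_zero

/-- A Gram matrix of traces of polynomials in `Z` with more rows than `Z` has eigenvalues is
singular. -/
lemma det_trace_aeval_eq_zero (Z : Mat N) {ι : Type*} [Fintype ι] [DecidableEq ι]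
    (hι : Z.charpoly.roots.toFinset.card < Fintype.card ι) (f g : ι → Polynomial ℂ) :
    (Matrix.of fun a b => (Polynomial.aeval Z (f a * g b)).trace).det = 0 := by
  let S := Z.charpoly.roots.toFinset
  let φ : (ι → ℂ) →ₗ[ℂ] (S → ℂ) :=
    { toFun := fun c ξ => ∑ a, c a * (f a).eval (ξ : ℂ)
      map_add' := fun c d => by funext ξ; simp [add_mul, Finset.sum_add_distrib]
      map_smul' := fun r c => by funext ξ; simp [mul_assoc, Finset.mul_sum] }
  have hker : LinearMap.ker φ ≠ ⊥ := by
    apply LinearMap.ker_ne_bot_of_finrank_lt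
    simpa [S] using hι
  obtain ⟨c, hc, hc0⟩ := (Submodule.ne_bot_iff _).1 hker
  refine Matrix.exists_vecMul_eq_zero_iff.1 ⟨c, hc0, ?_⟩
  funext b
  have := trace_aeval_eq_zero_of_roots Z ((∑ a, Polynomial.C (c a) * f a) * g b) (by
    intro ξ hξ
    have h := congrFun (LinearMap.mem_ker.1 hc) ⟨ξ, by simpa [S] using hξ⟩
    simp only [φ, LinearMap.coe_mk, AddHom.coe_mk, Pi.zero_apply] at h
    simp [Polynomial.eval_finsetSum, h])
  rw [Finset.sum_mul, map_sum, Matrix.trace_sum] at this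
  refine Eq.trans ?_ this
  simp [Matrix.vecMul, dotProduct, mul_assoc, Polynomial.aeval_C, Algebra.algebraMap_eq_smul_one,
    Matrix.trace_smul]

end Gram

/-- The Lax matrix of the rational Calogero–Moser system. -/
def cmLax {N : ℕ} (x p : Fin N → ℂ) (h : ℂ) : Mat N :=
  Matrix.diagonal p + h • Matrix.of fun i j => (x i - x j)⁻¹

section Spectral
variable {N : ℕ}

lemma dunkl_apply_coord (x p : Fin N → ℂ) (h : ℂ) (i : Fin N) (w : Fin N → ℂ) :
    dunkl x p h i (fun g => w (g⁻¹ i)) = fun g => (cmLax x p h).mulVec w (g⁻¹ i) := by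
  funext g
  rw [dunkl_apply, cmLax, Matrix.add_mulVec, Pi.add_apply, Matrix.mulVec_diagonal,
    Matrix.smul_mulVec, Pi.smul_apply, smul_eq_mul, Matrix.mulVec, dotProduct]
  congr 2
  rw [← Equiv.sum_comp g⁻¹ fun j => Matrix.of (fun i j => (x i - x j)⁻¹) (g⁻¹ i) j * w j]
  refine Finset.sum_congr rfl fun j _ => ?_
  simp only [Matrix.of_apply, mul_inv_rev, Equiv.swap_inv, Equiv.Perm.mul_apply,
    Equiv.swap_apply_left]

variable {x : Fin N → ℂ} (hx : Function.Injective x) (z p : Fin N → ℂ) (h : ℂ)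

/-- The monic polynomial whose value at `v` is the scalar by which `∏ i, (v - y i)` acts. -/
def dunklChar : Polynomial ℂ :=
  ∑ k ∈ Finset.range (N + 1), Polynomial.C (dunklEval hx z p h
    ((∏ i : Fin N, (Polynomial.X - Polynomial.C (X (Sum.inr i) : Rzl N))).coeff k)
    (Pi.single 1 1) 1) * Polynomial.X ^ k

lemma natDegree_prod_sub : (∏ i : Fin N,
    (Polynomial.X - Polynomial.C (X (Sum.inr i) : Rzl N))).natDegree = N := by
  rw [Polynomial.natDegree_prod_of_monic _ _ fun i _ => Polynomial.monic_X_sub_C _]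
  simp

lemma dunklEval_prod_univ (v : ℂ) :
    dunklEval hx z p h (∏ i, (C v - X (Sum.inr i)))
      = algebraMap ℂ _ ((dunklChar hx z p h).eval v) := by
  obtain ⟨c, hc⟩ := dunklEval_prod_univ_scalar hx z p h v
  rw [hc]
  congr 1
  have h1 := congrFun (LinearMap.congr_fun hc (Pi.single 1 1)) 1
  simp only [Module.algebraMap_end_apply, Pi.smul_apply, Pi.single_eq_same, smul_eq_mul,
    mul_one] at h1
  have h2 : (∏ i, (C v - X (Sum.inr i)) : Rzl N) = (∏ i : Fin N,
      (Polynomial.X - Polynomial.C (X (Sum.inr i) : Rzl N))).eval (C v) := by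
    simp [Polynomial.eval_prod]
  rw [← h1, h2, Polynomial.eval_eq_sum_range, natDegree_prod_sub, map_sum, dunklChar,
    Polynomial.eval_finsetSum, LinearMap.sum_apply, Finset.sum_apply]
  refine Finset.sum_congr rfl fun k _ => ?_
  rw [← map_pow, map_mul, dunklEval_C]
  simp only [Polynomial.eval_mul, Polynomial.eval_C, Polynomial.eval_pow, Polynomial.eval_X]
  rw [← Algebra.commutes, Module.End.mul_apply, Module.algebraMap_end_apply, Pi.smul_apply,
    smul_eq_mul, mul_comm]

lemma dunklChar_natDegree_le : (dunklChar hx z p h).natDegree ≤ N := by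
  refine Polynomial.natDegree_sum_le_of_forall_le _ _ fun k hk => ?_
  exact (Polynomial.natDegree_C_mul_X_pow_le _ _).trans (by simpa [Nat.lt_succ_iff] using hk)

lemma dunklChar_coeff : (dunklChar hx z p h).coeff N = 1 := by
  have h1 : (∏ i : Fin N, (Polynomial.X - Polynomial.C (X (Sum.inr i) : Rzl N))).coeff N = 1 := by
    have := (Polynomial.monic_prod_of_monic Finset.univ (fun i : Fin N =>
      (Polynomial.X - Polynomial.C (X (Sum.inr i) : Rzl N)))
      fun i _ => Polynomial.monic_X_sub_C _).coeff_natDegree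
    rwa [natDegree_prod_sub] at this
  simp [dunklChar, Polynomial.finsetSum_coeff, Polynomial.coeff_C_mul, Polynomial.coeff_X_pow, h1]

lemma dunklChar_eval_eq_zero {μ : ℂ} (hμ : (cmLax x p h).charpoly.eval μ = 0) :
    (dunklChar hx z p h).eval μ = 0 := by
  rw [Matrix.eval_charpoly] at hμ
  obtain ⟨w, hw, hw0⟩ := Matrix.exists_mulVec_eq_zero_iff.2 hμ
  obtain ⟨i, hi⟩ : ∃ i, w i ≠ 0 := by
    by_contra! hc
    exact hw (funext hc)
  have e : (cmLax x p h).mulVec w = μ • w := by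
    rw [Matrix.sub_mulVec, sub_eq_zero] at hw0
    rw [← hw0]
    simp [Matrix.scalar_apply]
  have h1 := congrFun (LinearMap.congr_fun (dunklEval_prod_univ hx z p h μ)
    (fun g => w (g⁻¹ i))) 1
  rw [← Finset.prod_erase_mul _ _ (Finset.mem_univ i), map_mul, Module.End.mul_apply,
    dunklEval_sub, LinearMap.sub_apply, dunkl_apply_coord, e] at h1
  have h2 : (algebraMap ℂ (Module.End ℂ (Equiv.Perm (Fin N) → ℂ)) μ) (fun g => w (g⁻¹ i))
      - (fun g => (μ • w) (g⁻¹ i)) = 0 := by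
    funext g
    simp
  rw [h2, map_zero] at h1
  exact (mul_eq_zero.1 h1.symm).resolve_right hi

lemma dunklChar_eq_of_roots (hd : N ≤ (cmLax x p h).charpoly.roots.toFinset.card) :
    dunklChar hx z p h = (cmLax x p h).charpoly := by
  have hn : (cmLax x p h).charpoly.natDegree = N := by simp
  have hm : (dunklChar hx z p h).Monic :=
    Polynomial.monic_of_natDegree_le_of_coeff_eq_one N (dunklChar_natDegree_le hx z p h)
      (dunklChar_coeff hx z p h)
  have hm' := (cmLax x p h).charpoly_monic
  have hn' : (dunklChar hx z p h).natDegree = N :=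
    le_antisymm (dunklChar_natDegree_le hx z p h)
      (Polynomial.le_natDegree_of_ne_zero (by simp [dunklChar_coeff]))
  refine Polynomial.eq_of_degree_le_of_eval_finset_eq
    (cmLax x p h).charpoly.roots.toFinset ?_ ?_ ?_ ?_
  · rw [Polynomial.degree_eq_natDegree hm.ne_zero, hn']
    exact_mod_cast hd
  · rw [Polynomial.degree_eq_natDegree hm.ne_zero, Polynomial.degree_eq_natDegree hm'.ne_zero,
      hn, hn']
  · rw [hm.leadingCoeff, hm'.leadingCoeff]
  · intro μ hμ
    have : (cmLax x p h).charpoly.eval μ = 0 := by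
      simpa [(cmLax x p h).charpoly_monic.ne_zero] using hμ
    rw [this, dunklChar_eval_eq_zero hx z p h this]

/-- The generalized characteristic polynomials are continuous in parameters. -/
lemma continuous_dunklEval {S : Type*} [TopologicalSpace S] (p : S → Fin N → ℂ) (h : S → ℂ)
    (hp : Continuous p) (hh : Continuous h) (r : Rzl N) :
    ∀ ψ : S → Equiv.Perm (Fin N) → ℂ, Continuous ψ →
      Continuous fun s => dunklEval hx z (p s) (h s) r (ψ s) := by
  induction r using MvPolynomial.induction_on with
  | C c =>
    intro ψ hψ
    simp only [dunklEval_C, Module.algebraMap_end_apply]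
    fun_prop
  | add f g hf hg =>
    intro ψ hψ
    simp only [map_add, LinearMap.add_apply]
    exact (hf ψ hψ).add (hg ψ hψ)
  | mul_X f i hf =>
    intro ψ hψ
    simp only [map_mul, Module.End.mul_apply]
    refine hf _ ?_
    rcases i with i | i
    · simp only [dunklEval_inl, Module.algebraMap_end_apply]
      fun_prop
    · simp only [dunklEval_inr]
      refine continuous_pi fun g => ?_
      simp only [dunkl_apply]
      fun_prop

lemma dense_eval_ne_zero {D : Polynomial ℂ} (hD : D ≠ 0) : Dense {s : ℂ | D.eval s ≠ 0} := by
  have : {s : ℂ | D.eval s ≠ 0} = ((D.roots.toFinset : Set ℂ))ᶜ := by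
    ext s; simp [hD]
  rw [this]
  exact (Finset.finite_toSet _).countable.dense_compl ℂ

lemma trace_pow_map {R S : Type*} [CommRing R] [CommRing S] (f : R →+* S)
    (A : Matrix (Fin N) (Fin N) R) (k : ℕ) : f (A ^ k).trace = ((A.map f) ^ k).trace := by
  rw [AddMonoidHom.map_trace, ← Matrix.map_pow]

lemma le_card_roots_of_det_ne_zero (A : Mat N)
    (hA : (Matrix.of fun a b : Fin N => (A ^ (a + b : ℕ)).trace).det ≠ 0) :
    N ≤ A.charpoly.roots.toFinset.card := by
  by_contra! hlt
  refine hA ?_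
  have := det_trace_aeval_eq_zero A (ι := Fin N) (by simpa using hlt)
    (fun a => Polynomial.X ^ (a : ℕ)) (fun a => Polynomial.X ^ (a : ℕ))
  simpa [← pow_add] using this

lemma det_trace_diagonal_pow_ne_zero {q : Fin N → ℂ} (hq : Function.Injective q) :
    (Matrix.of fun a b : Fin N => (Matrix.diagonal q ^ (a + b : ℕ)).trace).det ≠ 0 := by
  have : (Matrix.of fun a b : Fin N => (Matrix.diagonal q ^ (a + b : ℕ)).trace)
      = (Matrix.vandermonde q).transpose * Matrix.vandermonde q := by
    ext a b
    simp [Matrix.diagonal_pow, Matrix.mul_apply, Matrix.vandermonde_apply, pow_add,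
      Matrix.trace]
  rw [this, Matrix.det_mul, Matrix.det_transpose]
  exact mul_self_ne_zero.2 (Matrix.det_vandermonde_ne_zero_iff.2 hq)

lemma exists_polynomial_le_card_roots {q : Fin N → ℂ} (hq : Function.Injective q) (B : Mat N) :
    ∃ D : Polynomial ℂ, D ≠ 0 ∧ ∀ s, D.eval s ≠ 0 →
      N ≤ (Matrix.diagonal q + s • B).charpoly.roots.toFinset.card := by
  let A : Matrix (Fin N) (Fin N) (Polynomial ℂ) :=
    (Matrix.diagonal q).map Polynomial.C + (Polynomial.X : Polynomial ℂ) • B.map Polynomial.C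
  let D : Polynomial ℂ := (Matrix.of fun a b : Fin N => (A ^ (a + b : ℕ)).trace).det
  have hA : ∀ s, A.map (Polynomial.evalRingHom s) = Matrix.diagonal q + s • B := by
    intro s
    ext i j
    rcases eq_or_ne i j with rfl | hij
    · simp [A, mul_comm s]
    · simp [A, hij, mul_comm s]
  have hD : ∀ s, D.eval s = (Matrix.of fun a b : Fin N =>
      ((Matrix.diagonal q + s • B) ^ (a + b : ℕ)).trace).det := by
    intro s
    rw [← Polynomial.coe_evalRingHom, RingHom.map_det]
    congr 1
    ext a b
    simp only [RingHom.mapMatrix_apply, Matrix.map_apply, Matrix.of_apply]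
    rw [trace_pow_map, hA]
  refine ⟨D, fun h0 => ?_, fun s hs => le_card_roots_of_det_ne_zero _ (by rwa [← hD])⟩
  refine det_trace_diagonal_pow_ne_zero hq ?_
  have := hD 0
  rw [zero_smul, add_zero] at this
  rw [← this, h0, Polynomial.eval_zero]

lemma dunklEval_prod_univ_eq_charpoly (v : ℂ) :
    dunklEval hx z p h (∏ i, (C v - X (Sum.inr i)))
      = algebraMap ℂ _ ((cmLax x p h).charpoly.eval v) := by
  obtain ⟨q, hq⟩ : ∃ q : Fin N → ℂ, Function.Injective q :=
    ⟨fun i => ((i : ℕ) : ℂ), fun i j e => by simpa [Fin.ext_iff] using e⟩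
  set B := cmLax x p h - Matrix.diagonal q with hB
  obtain ⟨D, hD, hDs⟩ := exists_polynomial_le_card_roots hq B
  have hlax : ∀ s : ℂ, cmLax x (fun i => q i + s * (p i - q i)) (s * h)
      = Matrix.diagonal q + s • B := by
    intro s
    ext i j
    rcases eq_or_ne i j with rfl | hij
    · simp [cmLax, hB]
    · simp [cmLax, hB, hij, mul_assoc]
  rw [dunklEval_prod_univ]
  congr 1
  have hleft : Continuous fun s : ℂ =>
      (dunklChar hx z (fun i => q i + s * (p i - q i)) (s * h)).eval v := by
    simp only [dunklChar, Polynomial.eval_finsetSum, Polynomial.eval_mul, Polynomial.eval_C,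
      Polynomial.eval_pow, Polynomial.eval_X]
    refine continuous_finsetSum _ fun k _ => ?_
    refine Continuous.mul ?_ continuous_const
    exact (continuous_apply (1 : Equiv.Perm (Fin N))).comp
      (continuous_dunklEval hx z (fun (s : ℂ) i => q i + s * (p i - q i)) (fun s => s * h)
        (by fun_prop) (by fun_prop) _ _ continuous_const)
  have hright : Continuous fun s : ℂ =>
      (cmLax x (fun i => q i + s * (p i - q i)) (s * h)).charpoly.eval v := by
    simp only [hlax, Matrix.eval_charpoly]
    fun_prop
  have := congrFun (Continuous.ext_on (dense_eval_ne_zero hD) hleft hright fun s hs => by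
    rw [dunklChar_eq_of_roots hx z _ _ (by rw [hlax]; exact hDs s hs)]) 1
  simpa using this

end Spectral

/-- Permutations fixing every point outside of `J`. -/
def permsOn {N : ℕ} (J : Finset (Fin N)) : Finset (Equiv.Perm (Fin N)) :=
  Finset.univ.filter fun σ => ∀ k, k ∉ J → σ k = k

/-- The antisymmetrizer of the permutations supported on `J`. -/
def altOp {N : ℕ} (J : Finset (Fin N)) : Module.End ℂ (Equiv.Perm (Fin N) → ℂ) :=
  ∑ σ ∈ permsOn J, (Equiv.Perm.sign σ : ℤ) • transOp σ

/-- Multiplication by `∏ j ∈ J, (u - x_j)⁻¹`. -/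
def resolvOp {N : ℕ} (x : Fin N → ℂ) (u : ℂ) (J : Finset (Fin N)) :
    Module.End ℂ (Equiv.Perm (Fin N) → ℂ) :=
  diagOp fun g => ∏ j ∈ J, (u - x (g⁻¹ j))⁻¹

section Alternating
variable {N : ℕ}

lemma mem_permsOn {J : Finset (Fin N)} {σ : Equiv.Perm (Fin N)} :
    σ ∈ permsOn J ↔ ∀ k, k ∉ J → σ k = k := by
  simp [permsOn]

lemma sum_permsOn_insert {A : Type*} [AddCommMonoid A] {J : Finset (Fin N)} {i : Fin N}
    (hi : i ∉ J) (f : Equiv.Perm (Fin N) → A) :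
    ∑ σ ∈ permsOn (insert i J), f σ
      = ∑ j ∈ insert i J, ∑ σ ∈ permsOn J, f (σ * Equiv.swap i j) := by
  rw [← Finset.sum_fiberwise_of_maps_to (t := insert i J) (g := fun σ => σ⁻¹ i)]
  · refine Finset.sum_congr rfl fun j hj => ?_
    refine Finset.sum_nbij' (fun σ => σ * Equiv.swap i j) (fun σ => σ * Equiv.swap i j)
      ?_ ?_ ?_ ?_ ?_
    · intro σ hσ
      simp only [Finset.mem_filter, mem_permsOn] at hσ ⊢
      intro k hk
      rw [Equiv.Perm.mul_apply]
      rcases eq_or_ne k i with rfl | hki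
      · rw [Equiv.swap_apply_left, ← hσ.2]
        exact σ.apply_symm_apply k
      · have hkj : k ≠ j := by
          rintro rfl
          exact hk ((Finset.mem_insert.1 hj).resolve_left hki)
        rw [Equiv.swap_apply_of_ne_of_ne hki hkj]
        exact hσ.1 k (by simp [hki, hk])
    · intro σ hσ
      simp only [Finset.mem_filter, mem_permsOn] at hσ ⊢
      constructor
      · intro k hk
        have hki : k ≠ i := fun e => hk (by simp [e])
        have hkj : k ≠ j := fun e => hk (e ▸ hj)
        rw [Equiv.Perm.mul_apply, Equiv.swap_apply_of_ne_of_ne hki hkj]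
        exact hσ k fun h => hk (by simp [h])
      · have : σ⁻¹ i = i := by
          rw [Equiv.Perm.inv_eq_iff_eq]
          exact (hσ i hi).symm
        rw [mul_inv_rev, Equiv.swap_inv, Equiv.Perm.mul_apply, this, Equiv.swap_apply_left]
    · intro σ _
      simp [mul_assoc]
    · intro σ _
      simp [mul_assoc]
    · intro σ _
      simp [mul_assoc]
  · intro σ hσ
    rw [mem_permsOn] at hσ
    by_contra hc
    have h1 := hσ _ hc
    have h2 : σ (σ⁻¹ i) = i := σ.apply_symm_apply i
    rw [h2] at h1
    rw [← h1] at hc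
    simp at hc

lemma altOp_insert {J : Finset (Fin N)} {i : Fin N} (hi : i ∉ J) :
    altOp (insert i J) = altOp J * (1 - ∑ j ∈ J, transOp (Equiv.swap i j)) := by
  rw [altOp, sum_permsOn_insert hi, Finset.sum_insert hi, mul_sub, mul_one, Finset.mul_sum,
    sub_eq_add_neg, ← Finset.sum_neg_distrib]
  congr 1
  · simp [altOp, Equiv.Perm.one_def.symm]
  · refine Finset.sum_congr rfl fun j hj => ?_
    have hij : i ≠ j := fun e => hi (e ▸ hj)
    rw [altOp, Finset.sum_mul, ← Finset.sum_neg_distrib]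
    refine Finset.sum_congr rfl fun σ _ => ?_
    rw [Equiv.Perm.sign_mul, Equiv.Perm.sign_swap hij, transOp_mul]
    simp [mul_assoc]

lemma altOp_mul_sub_dunkl {J : Finset (Fin N)} {i : Fin N} (hi : i ∉ J) (x p : Fin N → ℂ)
    (h v : ℂ) :
    altOp J * (algebraMap ℂ _ v - dunkl x p h i)
      = (algebraMap ℂ _ v - dunkl x p h i) * altOp J := by
  rw [altOp, Finset.sum_mul, Finset.mul_sum]
  refine Finset.sum_congr rfl fun σ hσ => ?_
  rw [smul_mul_assoc, mul_smul_comm, transOp_mul_sub_dunkl, mem_permsOn.1 hσ i hi]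

lemma transOp_mul_resolvOp (x : Fin N → ℂ) (u : ℂ) (J : Finset (Fin N)) {i j : Fin N}
    (hi : i ∈ J) (hj : j ∈ J) :
    transOp (Equiv.swap i j) * resolvOp x u J = resolvOp x u J * transOp (Equiv.swap i j) := by
  rw [resolvOp, transOp_mul_diagOp]
  congr 2
  funext g
  refine Finset.prod_nbij' (Equiv.swap i j) (Equiv.swap i j) ?_ ?_ ?_ ?_ ?_
  · intro k hk
    rcases eq_or_ne k i with rfl | h1
    · simpa
    rcases eq_or_ne k j with rfl | h2
    · simpa
    simpa [Equiv.swap_apply_of_ne_of_ne h1 h2]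
  · intro k hk
    rcases eq_or_ne k i with rfl | h1
    · simpa
    rcases eq_or_ne k j with rfl | h2
    · simpa
    simpa [Equiv.swap_apply_of_ne_of_ne h1 h2]
  · simp
  · simp
  · intro k _
    simp only [mul_inv_rev, Equiv.swap_inv, Equiv.Perm.mul_apply]

lemma dunkl_mul_resolvOp {x : Fin N → ℂ} (hx : Function.Injective x) (p : Fin N → ℂ)
    {u : ℂ} (hu : ∀ i, u ≠ x i) {J : Finset (Fin N)} {i : Fin N} (hi : i ∉ J) :
    dunkl x p 1 i * resolvOp x u J = resolvOp x u J * dunkl x p 1 i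
      + ∑ j ∈ J, transOp (Equiv.swap i j) * resolvOp x u (insert i J) := by
  rw [resolvOp, dunkl_mul_diagOp, one_smul]
  congr 1
  rw [← Finset.sum_subset (Finset.subset_univ J)]
  · refine Finset.sum_congr rfl fun j hj => ?_
    rw [transOp_mul_resolvOp _ _ _ (Finset.mem_insert_self i J) (Finset.mem_insert_of_mem hj),
      resolvOp]
    congr 2
    funext g
    have hij : i ≠ j := fun e => hi (e ▸ hj)
    have hne : x (g⁻¹ i) - x (g⁻¹ j) ≠ 0 :=
      sub_ne_zero.2 fun h => hij (g⁻¹.injective (hx h))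
    have h1 : u - x (g⁻¹ i) ≠ 0 := sub_ne_zero.2 (hu _)
    have h2 : u - x (g⁻¹ j) ≠ 0 := sub_ne_zero.2 (hu _)
    rw [Finset.prod_insert hi, ← Finset.mul_prod_erase _ _ hj, ← Finset.mul_prod_erase J _ hj]
    have e : ∏ k ∈ J.erase j, (u - x ((Equiv.swap i j * g)⁻¹ k))⁻¹
        = ∏ k ∈ J.erase j, (u - x (g⁻¹ k))⁻¹ := by
      refine Finset.prod_congr rfl fun k hk => ?_
      rw [Finset.mem_erase] at hk
      rw [mul_inv_rev, Equiv.swap_inv, Equiv.Perm.mul_apply,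
        Equiv.swap_apply_of_ne_of_ne (ne_of_mem_of_not_mem hk.2 hi) hk.1]
    rw [e, mul_inv_rev, Equiv.swap_inv, Equiv.Perm.mul_apply, Equiv.swap_apply_right]
    field_simp
    ring
  · intro j _ hj
    refine LinearMap.ext fun ψ => funext fun g => ?_
    have e : ∏ k ∈ J, (u - x ((Equiv.swap i j * g)⁻¹ k))⁻¹ = ∏ k ∈ J, (u - x (g⁻¹ k))⁻¹ := by
      refine Finset.prod_congr rfl fun k hk => ?_
      rw [mul_inv_rev, Equiv.swap_inv, Equiv.Perm.mul_apply,
        Equiv.swap_apply_of_ne_of_ne (ne_of_mem_of_not_mem hk hi) (ne_of_mem_of_not_mem hk hj)]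
    simp only [Module.End.mul_apply, diagOp_apply, e, sub_self, mul_zero, zero_mul,
      LinearMap.zero_apply, Pi.zero_apply]

lemma dunkl_shift (x p : Fin N → ℂ) (u h : ℂ) (i : Fin N) :
    dunkl x (fun j => p j + (u - x j)⁻¹) h i = dunkl x p h i + resolvOp x u {i} := by
  refine LinearMap.ext fun ψ => funext fun g => ?_
  rw [dunkl_apply, LinearMap.add_apply, Pi.add_apply, dunkl_apply, resolvOp, diagOp_apply,
    Finset.prod_singleton]
  ring

lemma resolvOp_mul_singleton (x : Fin N → ℂ) (u : ℂ) {J : Finset (Fin N)} {i : Fin N}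
    (hi : i ∉ J) : resolvOp x u J * resolvOp x u {i} = resolvOp x u (insert i J) := by
  rw [resolvOp, resolvOp, resolvOp, diagOp_mul]
  congr 1
  funext g
  rw [Finset.prod_singleton, Finset.prod_insert hi, mul_comm]

lemma dunklEval_shift_prod {x : Fin N → ℂ} (hx : Function.Injective x) (z p : Fin N → ℂ)
    {u : ℂ} (hu : ∀ i, u ≠ x i) (v : ℂ) (K : Finset (Fin N)) :
    dunklEval hx z (fun j => p j + (u - x j)⁻¹) 1 (∏ i ∈ K, (C v - X (Sum.inr i)))
      = ∑ J ∈ K.powerset, (-1 : ℤ) ^ J.card •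
          (dunklEval hx z p 1 (∏ i ∈ K \ J, (C v - X (Sum.inr i))) *
            (altOp J * resolvOp x u J)) := by
  induction K using Finset.induction_on with
  | empty =>
    have : permsOn (∅ : Finset (Fin N)) = {1} := by
      ext σ
      simp [mem_permsOn, Equiv.ext_iff]
    have h2 : resolvOp x u ∅ = 1 := by
      refine LinearMap.ext fun ψ => funext fun g => ?_
      simp [resolvOp]
    simp [altOp, this, transOp_one, h2]
  | insert i K hi ih =>
    rw [Finset.prod_insert hi, mul_comm, map_mul, ih, dunklEval_sub, dunkl_shift,
      Finset.sum_powerset_insert hi, Finset.sum_mul, ← Finset.sum_add_distrib]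
    refine Finset.sum_congr rfl fun J hJ => ?_
    rw [Finset.mem_powerset] at hJ
    have hiJ : i ∉ J := fun h => hi (hJ h)
    rw [Finset.insert_sdiff_of_notMem _ hiJ, Finset.prod_insert (by simp [hi]), mul_comm (C v - _),
      map_mul, dunklEval_sub, Finset.card_insert_of_notMem hiJ,
      Finset.insert_sdiff_insert, Finset.sdiff_insert_of_notMem hi, altOp_insert hiJ, smul_mul_assoc,
      pow_succ,
      mul_smul, ← smul_add]
    congr 1
    have hγ := dunkl_mul_resolvOp hx p hu hiJ
    rw [mul_assoc, mul_assoc, ← sub_sub, mul_sub (resolvOp x u J), resolvOp_mul_singleton x u hiJ,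
      mul_assoc _ (algebraMap ℂ _ v - dunkl x p 1 i), ← mul_assoc (algebraMap ℂ _ v - dunkl x p 1 i),
      ← altOp_mul_sub_dunkl hiJ, mul_assoc (altOp J) (algebraMap ℂ _ v - dunkl x p 1 i),
      sub_mul (algebraMap ℂ _ v), hγ, mul_sub (resolvOp x u J), ← Algebra.commutes v]
    rw [neg_smul, one_smul, ← sub_eq_add_neg, ← mul_sub, mul_assoc, ← mul_sub,
      sub_mul (1 : Module.End ℂ (Equiv.Perm (Fin N) → ℂ)), one_mul,
      Finset.sum_mul]
    congr 2
    abel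

end Alternating

section Bivariate
variable {N : ℕ}

lemma cmPoly_eval (Z Λ : Mat N) (u v : ℂ) :
    ((cmPoly Z Λ).eval (Polynomial.C u)).eval v
      = ((v • (1 : Mat N) - Λ) * (u • (1 : Mat N) - Z) - 1).det := by
  let φ : Polynomial (Polynomial ℂ) →+* ℂ :=
    (Polynomial.evalRingHom v).comp (Polynomial.evalRingHom (Polynomial.C u))
  change φ (cmPoly Z Λ) = _
  rw [cmPoly, RingHom.map_det, map_sub, map_mul, map_sub, map_sub, map_one]
  have h1 : φ.mapMatrix ((Polynomial.C Polynomial.X : Polynomial (Polynomial ℂ)) •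
      (1 : Matrix (Fin N) (Fin N) (Polynomial (Polynomial ℂ)))) = v • (1 : Mat N) := by
    ext i j
    rcases eq_or_ne i j with rfl | hij <;> simp [φ, *]
  have h2 : φ.mapMatrix ((Polynomial.X : Polynomial (Polynomial ℂ)) •
      (1 : Matrix (Fin N) (Fin N) (Polynomial (Polynomial ℂ)))) = u • (1 : Mat N) := by
    ext i j
    rcases eq_or_ne i j with rfl | hij <;> simp [φ, *]
  have h3 : ∀ A : Mat N, φ.mapMatrix (A.map fun c => Polynomial.C (Polynomial.C c)) = A := by
    intro A
    ext i j
    simp [φ]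
  rw [h1, h2, h3, h3]

lemma bivariate_ext {P Q : Polynomial (Polynomial ℂ)} (s : Set ℂ) (hs : s.Infinite)
    (h : ∀ u ∈ s, ∀ v, (P.eval (Polynomial.C u)).eval v = (Q.eval (Polynomial.C u)).eval v) :
    P = Q := by
  have key : ∀ (P : Polynomial (Polynomial ℂ)) (u v : ℂ), (P.eval (Polynomial.C u)).eval v
      = (P.map (Polynomial.evalRingHom v)).eval u := by
    intro P u v
    rw [Polynomial.eval_map, ← Polynomial.coe_evalRingHom, Polynomial.eval, Polynomial.hom_eval₂]
    simp
  have h1 : ∀ v, P.map (Polynomial.evalRingHom v) = Q.map (Polynomial.evalRingHom v) := by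
    intro v
    refine Polynomial.eq_of_infinite_eval_eq _ _ (hs.mono fun u hu => ?_)
    simpa only [key, Set.mem_ofPred_eq] using h u hu v
  refine Polynomial.ext fun k => Polynomial.funext fun v => ?_
  simpa using congrArg (fun p => p.coeff k) (h1 v)

lemma coeff_coeff_sum_bivariate (c : Fin (N + 1) → Fin (N + 1) → ℂ) (i j : Fin (N + 1)) :
    ((∑ a : Fin (N + 1), ∑ b : Fin (N + 1), Polynomial.C (Polynomial.C (c a b) *
      Polynomial.X ^ (N - (b : ℕ))) * Polynomial.X ^ (N - (a : ℕ))).coeff (N - (i : ℕ))).coeff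
      (N - (j : ℕ)) = c i j := by
  have hinj : ∀ a b : Fin (N + 1), N - (a : ℕ) = N - (b : ℕ) ↔ a = b := by
    intro a b
    rw [Fin.ext_iff]
    omega
  simp only [Polynomial.finsetSum_coeff, Polynomial.coeff_C_mul, Polynomial.coeff_X_pow, hinj,
    mul_ite, mul_one, mul_zero]
  rw [Finset.sum_eq_single i, Finset.sum_eq_single j]
  · simp
  · intro b _ hb
    simp [hinj, hb.symm]
  · simp
  · intro a _ ha
    simp [ha.symm]
  · simp

end Bivariate

/-- The map `V_1 → (S_N → ℂ)` attached to a point of the Calogero–Moser space. -/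
def bethePsi {N : ℕ} {x : Fin N → ℂ} (hx : Function.Injective x) (p : Fin N → ℂ) :
    V1 N →ₗ[ℂ] (Equiv.Perm (Fin N) → ℂ) where
  toFun F := ∑ τ, dunklEval hx x p 1 (F τ) (Pi.single τ 1)
  map_add' F G := by simp [Finset.sum_add_distrib]
  map_smul' c F := by simp [Finset.smul_sum]

section Intertwine
variable {N : ℕ} {x : Fin N → ℂ} (hx : Function.Injective x) (p : Fin N → ℂ)

lemma charpoly_shift_mul_prod {u : ℂ} (hu : ∀ i, u ≠ x i) (v : ℂ) :
    (∏ i, (u - x i)) * (cmLax x (fun j => p j + (u - x j)⁻¹) 1).charpoly.eval v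
      = ((v • (1 : Mat N) - cmLax x p 1) * (u • (1 : Mat N) - Matrix.diagonal x) - 1).det := by
  rw [Matrix.eval_charpoly, mul_comm, ← Matrix.det_diagonal, ← Matrix.det_mul]
  congr 1
  have h1 : cmLax x (fun j => p j + (u - x j)⁻¹) 1
      = cmLax x p 1 + Matrix.diagonal fun j => (u - x j)⁻¹ := by
    simp only [cmLax, ← Matrix.diagonal_add]
    abel
  have h2 : (u • (1 : Mat N) - Matrix.diagonal x) = Matrix.diagonal fun i => u - x i := by
    ext i j
    rcases eq_or_ne i j with rfl | hij <;> simp [*]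
  have h3 : (Matrix.diagonal fun j => (u - x j)⁻¹) * (Matrix.diagonal fun i => u - x i) = 1 := by
    rw [Matrix.diagonal_mul_diagonal, ← Matrix.diagonal_one]
    congr 1
    funext i
    exact inv_mul_cancel₀ (sub_ne_zero.2 (hu i))
  rw [h1, h2, ← sub_sub, sub_mul _ _ (Matrix.diagonal fun i => u - x i), h3]
  simp [Matrix.smul_one_eq_diagonal]

lemma dunklEval_prod_mixed (u v : ℂ) (τ : Equiv.Perm (Fin N)) (I : Finset (Fin N)) :
    dunklEval hx x p 1 (∏ i ∈ I, ((C u - X (Sum.inl (τ⁻¹ i))) * (C v - X (Sum.inr i))))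
      = (∏ i ∈ I, (u - x (τ⁻¹ i))) • dunklEval hx x p 1 (∏ i ∈ I, (C v - X (Sum.inr i))) := by
  induction I using Finset.induction_on with
  | empty => simp
  | insert i I hi ih =>
    have h : dunklEval hx x p 1 (C u - X (Sum.inl (τ⁻¹ i)))
        = algebraMap ℂ _ (u - x (τ⁻¹ i)) := by
      rw [map_sub, dunklEval_C, dunklEval_inl, ← map_sub]
    simp only [Finset.prod_insert hi]
    rw [map_mul, map_mul, h, ih, map_mul, mul_smul, mul_smul_comm, Algebra.smul_def (u - _),
      mul_assoc, mul_smul_comm]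

lemma resolvOp_single (u : ℂ) (J : Finset (Fin N)) (τ : Equiv.Perm (Fin N)) :
    resolvOp x u J (Pi.single τ 1) = (∏ j ∈ J, (u - x (τ⁻¹ j))⁻¹) •
      (Pi.single τ 1 : Equiv.Perm (Fin N) → ℂ) := by
  funext g
  rcases eq_or_ne g τ with rfl | h
  · simp [resolvOp]
  · simp [resolvOp, h]

lemma transOp_single (σ τ : Equiv.Perm (Fin N)) :
    transOp σ (Pi.single τ 1 : Equiv.Perm (Fin N) → ℂ) = Pi.single (σ * τ) 1 := by
  funext a
  simp [Pi.single_apply, inv_mul_eq_iff_eq_mul]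

lemma bethe_apply_single {u : ℂ} (hu : ∀ i, u ≠ x i) (v : ℂ) (τ : Equiv.Perm (Fin N))
    (r : Rzl N) :
    ((-1 : ℤ) ^ N) • ∑ σ : Equiv.Perm (Fin N), (Equiv.Perm.sign σ : ℤ) •
      dunklEval hx x p 1 ((∏ i ∈ Finset.univ.filter (fun i => σ i = i),
        (1 - ((C u : Rzl N) - X (Sum.inl (τ⁻¹ i))) * ((C v : Rzl N) - X (Sum.inr i)))) * r)
        (Pi.single (σ * τ) 1)
      = ((v • (1 : Mat N) - cmLax x p 1) * (u • (1 : Mat N) - Matrix.diagonal x) - 1).det •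
        dunklEval hx x p 1 r (Pi.single τ 1) := by
  set ev := dunklEval hx x p 1 with hev
  set δ : Equiv.Perm (Fin N) → ℂ := Pi.single τ 1 with hδ
  have expand : ∀ σ : Equiv.Perm (Fin N),
      ev ((∏ i ∈ Finset.univ.filter (fun i => σ i = i),
        (1 - ((C u : Rzl N) - X (Sum.inl (τ⁻¹ i))) * ((C v : Rzl N) - X (Sum.inr i)))) * r)
        (Pi.single (σ * τ) 1)
      = ∑ I ∈ (Finset.univ.filter (fun i => σ i = i)).powerset,
        ev r ((-1 : ℤ) ^ I.card • (∏ i ∈ I, (u - x (τ⁻¹ i))) •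
          ev (∏ i ∈ I, (C v - X (Sum.inr i))) (transOp σ δ)) := by
    intro σ
    simp only [sub_eq_add_neg (1 : Rzl N)]
    rw [mul_comm, map_mul, Module.End.mul_apply, Finset.prod_one_add, map_sum,
      LinearMap.sum_apply, map_sum, ← transOp_single]
    refine Finset.sum_congr rfl fun I _ => ?_
    have hneg : ∀ (k : ℕ) (q : Rzl N), (-1) ^ k * q = (-1 : ℤ) ^ k • q := by simp
    rw [Finset.prod_neg, hneg, map_zsmul, hev, dunklEval_prod_mixed, LinearMap.smul_apply,
      LinearMap.smul_apply]
  simp only [expand]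
  have swap : ∑ σ : Equiv.Perm (Fin N), (Equiv.Perm.sign σ : ℤ) •
        ∑ I ∈ (Finset.univ.filter (fun i => σ i = i)).powerset,
        ev r ((-1 : ℤ) ^ I.card • (∏ i ∈ I, (u - x (τ⁻¹ i))) •
          ev (∏ i ∈ I, (C v - X (Sum.inr i))) (transOp σ δ))
      = ∑ I : Finset (Fin N), ev r ((-1 : ℤ) ^ I.card • (∏ i ∈ I, (u - x (τ⁻¹ i))) •
          ev (∏ i ∈ I, (C v - X (Sum.inr i))) (altOp Iᶜ δ)) := by
    simp only [Finset.smul_sum]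
    rw [Finset.sum_comm' (t' := Finset.univ) (s' := fun I => permsOn Iᶜ)]
    · refine Finset.sum_congr rfl fun I _ => ?_
      simp only [altOp, LinearMap.sum_apply, map_sum, Finset.smul_sum, LinearMap.smul_apply,
        map_zsmul]
      refine Finset.sum_congr rfl fun σ _ => ?_
      rw [smul_comm (∏ i ∈ I, (u - x (τ⁻¹ i))) (Equiv.Perm.sign σ : ℤ), map_zsmul, smul_comm]
    · intro σ I
      simp [mem_permsOn, Finset.subset_iff]
  rw [swap, ← (compl_bijective (α := Finset (Fin N))).sum_comp, Finset.smul_sum]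
  have hfin := LinearMap.congr_fun (dunklEval_shift_prod hx x p hu v Finset.univ) δ
  rw [dunklEval_prod_univ_eq_charpoly] at hfin
  rw [← charpoly_shift_mul_prod p hu, mul_smul, ← map_smul, ← map_smul]
  rw [Module.algebraMap_end_apply] at hfin
  rw [hfin, LinearMap.sum_apply, Finset.smul_sum, map_sum, Finset.powerset_univ]
  refine Finset.sum_congr rfl fun J _ => ?_
  rw [← map_zsmul]
  congr 1
  rw [LinearMap.smul_apply, Module.End.mul_apply, Module.End.mul_apply, resolvOp_single, map_smul,
    map_smul, compl_compl, smul_comm _ ((-1 : ℤ) ^ J.card), smul_smul (∏ i, (u - x i)), smul_smul]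
  have hs : (-1 : ℤ) ^ N * (-1) ^ Jᶜ.card = (-1) ^ J.card := by
    have hpow : ∀ a b n : ℕ, a + b = n → (-1 : ℤ) ^ n * (-1) ^ b = (-1) ^ a := by
      rintro a b _ rfl
      rw [pow_add, mul_assoc, ← mul_pow]
      simp
    exact hpow _ _ _ (by simp [Finset.card_add_card_compl])
  have hp : (∏ i, (u - x i)) * ∏ j ∈ J, (u - x (τ⁻¹ j))⁻¹ = ∏ i ∈ Jᶜ, (u - x (τ⁻¹ i)) := by
    rw [← Equiv.prod_comp τ⁻¹ fun i => u - x i, ← Finset.prod_mul_prod_compl J, mul_comm,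
      ← mul_assoc, ← Finset.prod_mul_distrib, Finset.prod_eq_one, one_mul]
    intro i _
    exact inv_mul_cancel₀ (sub_ne_zero.2 (hu _))
  rw [hs, hp, Finset.compl_eq_univ_sdiff]

lemma bethePsi_apply (F : V1 N) :
    bethePsi hx p F = ∑ τ, dunklEval hx x p 1 (F τ) (Pi.single τ 1) := rfl

lemma PB_apply (u v : ℂ) (F : V1 N) (ρ : Equiv.Perm (Fin N)) :
    PB N u v F ρ = ((-1 : ℤ) ^ N) • ∑ σ : Equiv.Perm (Fin N), (Equiv.Perm.sign σ : ℤ) •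
      ((∏ i ∈ Finset.univ.filter (fun i => σ i = i), (1 - ((C u : Rzl N) -
        X (Sum.inl ((σ⁻¹ * ρ)⁻¹ i))) * ((C v : Rzl N) - X (Sum.inr i)))) * F (σ⁻¹ * ρ)) := by
  rw [PB, LinearMap.smul_apply, LinearMap.sum_apply, Pi.smul_apply, Finset.sum_apply]
  rfl

lemma bethePsi_PB {u : ℂ} (hu : ∀ i, u ≠ x i) (v : ℂ) (F : V1 N) :
    bethePsi hx p (PB N u v F) = ((v • (1 : Mat N) - cmLax x p 1) *
      (u • (1 : Mat N) - Matrix.diagonal x) - 1).det • bethePsi hx p F := by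
  let G : Equiv.Perm (Fin N) → Equiv.Perm (Fin N) → Equiv.Perm (Fin N) → ℂ := fun σ τ =>
    dunklEval hx x p 1 ((∏ i ∈ Finset.univ.filter (fun i => σ i = i),
        (1 - ((C u : Rzl N) - X (Sum.inl (τ⁻¹ i))) * ((C v : Rzl N) - X (Sum.inr i)))) * F τ)
        (Pi.single (σ * τ) 1)
  have hl : ∀ ρ, dunklEval hx x p 1 (PB N u v F ρ) (Pi.single ρ 1)
      = ((-1 : ℤ) ^ N) • ∑ σ : Equiv.Perm (Fin N), (Equiv.Perm.sign σ : ℤ) • G σ (σ⁻¹ * ρ) := by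
    intro ρ
    rw [PB_apply, map_zsmul, map_sum, LinearMap.smul_apply, LinearMap.sum_apply]
    congr 1
    refine Finset.sum_congr rfl fun σ _ => ?_
    rw [map_zsmul, LinearMap.smul_apply]
    simp only [G, mul_inv_cancel_left]
  rw [bethePsi_apply, bethePsi_apply, Finset.smul_sum, Finset.sum_congr rfl fun ρ _ => hl ρ,
    ← Finset.sum_congr rfl fun τ _ => bethe_apply_single hx p hu v τ (F τ), ← Finset.smul_sum,
    ← Finset.smul_sum, Finset.sum_comm]
  congr 1
  refine Eq.trans ?_ Finset.sum_comm
  refine Finset.sum_congr rfl fun σ _ => ?_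
  rw [← Equiv.sum_comp (Equiv.mulLeft σ)]
  refine Finset.sum_congr rfl fun τ _ => ?_
  rw [Equiv.coe_mulLeft, inv_mul_cancel_left]

end Intertwine

section Coefficients
variable {N : ℕ} {x : Fin N → ℂ} (hx : Function.Injective x) (p : Fin N → ℂ)

lemma bethePsi_coeff {bb : Fin (N + 1) → Fin (N + 1) → Module.End ℂ (V1 N)}
    (hb : ∀ u v : ℂ, PB N u v =
      ∑ i : Fin (N + 1), ∑ j : Fin (N + 1), (u ^ (N - (i : ℕ)) * v ^ (N - (j : ℕ))) • bb i j)
    (i j : Fin (N + 1)) (F : V1 N) :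
    bethePsi hx p (bb i j F)
      = mcoeff N i j (Matrix.diagonal x) (cmLax x p 1) • bethePsi hx p F := by
  funext g
  have key : ∑ a : Fin (N + 1), ∑ b : Fin (N + 1),
        Polynomial.C (Polynomial.C (bethePsi hx p (bb a b F) g) *
          Polynomial.X ^ (N - (b : ℕ))) * Polynomial.X ^ (N - (a : ℕ))
      = cmPoly (Matrix.diagonal x) (cmLax x p 1) *
        Polynomial.C (Polynomial.C (bethePsi hx p F g)) := by
    refine bivariate_ext (Set.range x)ᶜ (Set.finite_range x).infinite_compl fun u hu v => ?_
    have h1 := congrFun (bethePsi_PB hx p (fun i e => hu ⟨i, e.symm⟩) v F) g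
    rw [hb, ← cmPoly_eval] at h1
    simp only [LinearMap.sum_apply, LinearMap.smul_apply, map_sum, map_smul, Finset.sum_apply,
      Pi.smul_apply, smul_eq_mul] at h1
    simp only [Polynomial.eval_mul, Polynomial.eval_C, Polynomial.eval_finsetSum,
      Polynomial.eval_pow, Polynomial.eval_X]
    rw [← h1]
    refine Finset.sum_congr rfl fun a _ => Finset.sum_congr rfl fun b _ => ?_
    ring
  have h2 := coeff_coeff_sum_bivariate (fun a b => bethePsi hx p (bb a b F) g) i j
  rw [key, Polynomial.coeff_mul_C, Polynomial.coeff_mul_C] at h2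
  exact h2.symm

/-- Substitution into an intertwined family acts by substitution of the scalars. -/
lemma substB_apply_of_intertwine {W : Type*} [AddCommGroup W] [Module ℂ W] (Ψ : V1 N →ₗ[ℂ] W)
    {bb : Fin (N + 1) → Fin (N + 1) → Module.End ℂ (V1 N)} {m : Fin (N + 1) × Fin (N + 1) → ℂ}
    (h : ∀ i j F, Ψ (bb i j F) = m (i, j) • Ψ F)
    (R : MvPolynomial (Fin (N + 1) × Fin (N + 1)) ℂ) (F : V1 N) :
    Ψ (substB N bb R F) = MvPolynomial.eval m R • Ψ F := by
  have hpow : ∀ (T : Module.End ℂ (V1 N)) (c : ℂ), (∀ F, Ψ (T F) = c • Ψ F) →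
      ∀ (k : ℕ) (F : V1 N), Ψ ((T ^ k) F) = c ^ k • Ψ F := by
    intro T c hT k
    induction k with
    | zero => simp
    | succ k ih =>
      intro F
      rw [pow_succ', Module.End.mul_apply, hT, ih, pow_succ', mul_smul]
  have hlist : ∀ (l : List (Fin (N + 1))) (T : Fin (N + 1) → Module.End ℂ (V1 N))
      (c : Fin (N + 1) → ℂ), (∀ a F, Ψ (T a F) = c a • Ψ F) →
      ∀ F, Ψ ((l.map T).prod F) = (l.map c).prod • Ψ F := by
    intro l T c hT
    induction l with
    | nil => simp
    | cons a l ih =>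
      intro F
      rw [List.map_cons, List.prod_cons, List.map_cons, List.prod_cons, Module.End.mul_apply, hT,
        ih, mul_smul]
  rw [substB, LinearMap.sum_apply, map_sum, MvPolynomial.eval_eq', Finset.sum_smul]
  refine Finset.sum_congr rfl fun d _ => ?_
  rw [LinearMap.smul_apply, map_smul, mul_smul, Fintype.prod_prod_type, Fin.prod_univ_def]
  congr 1
  refine hlist _ _ _ (fun i F => ?_) F
  rw [Fin.prod_univ_def]
  exact hlist _ _ _ (fun j F => hpow _ _ (h i j) _ F) F

lemma bethePsi_single_one_ne_zero :
    bethePsi hx p (Pi.single 1 1) ≠ 0 := by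
  intro h
  have := congrFun h 1
  rw [bethePsi_apply, Finset.sum_eq_single 1] at this
  · simp at this
  · intro τ _ hτ
    rw [Pi.single_eq_of_ne hτ, map_zero, LinearMap.zero_apply]
  · simp

end Coefficients

section Injectivity
variable {N : ℕ}

/-- Rescaling of the variables `λ_i` by a formal parameter. -/
def lambdaScale : Rzl N →ₐ[ℂ] Polynomial (Rzl N) :=
  aeval (Sum.elim (fun i => Polynomial.C (X (Sum.inl i)))
    (fun i => Polynomial.X * Polynomial.C (X (Sum.inr i))))

lemma lambdaScale_eval_one (r : Rzl N) : (lambdaScale r).eval 1 = r := by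
  induction r using MvPolynomial.induction_on with
  | C c => simp [lambdaScale]
  | add f g hf hg => rw [map_add, Polynomial.eval_add, hf, hg]
  | mul_X f i hf =>
    rw [map_mul, Polynomial.eval_mul, hf]
    rcases i with i | i <;> simp [lambdaScale]

variable {x : Fin N → ℂ} (hx : Function.Injective x) (z p : Fin N → ℂ)

lemma dunkl_smul (s : ℂ) (hs : s ≠ 0) (i : Fin N) :
    dunkl x (s • p) 1 i = s • dunkl x p s⁻¹ i := by
  refine LinearMap.ext fun ψ => funext fun g => ?_
  simp only [dunkl_apply, LinearMap.smul_apply, Pi.smul_apply, smul_eq_mul]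
  field_simp

lemma dunklEval_scale (s : ℂ) (hs : s ≠ 0) (r : Rzl N) :
    dunklEval hx z (s • p) 1 r = dunklEval hx z p s⁻¹ ((lambdaScale r).eval (C s)) := by
  induction r using MvPolynomial.induction_on with
  | C c => simp [lambdaScale]
  | add f g hf hg => rw [map_add, map_add, Polynomial.eval_add, map_add, hf, hg]
  | mul_X f i hf =>
    rw [map_mul, map_mul, Polynomial.eval_mul, map_mul, hf]
    congr 1
    rcases i with i | i
    · simp [lambdaScale, dunklEval_inl]
    · simp only [lambdaScale, aeval_X, Sum.elim_inr, Polynomial.eval_mul, Polynomial.eval_X,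
        Polynomial.eval_C, map_mul, dunklEval_C, dunklEval_inr, dunkl_smul _ s hs]
      rw [Algebra.smul_def]

lemma dunklEval_zero (r : Rzl N) (ψ : Equiv.Perm (Fin N) → ℂ) (g : Equiv.Perm (Fin N)) :
    dunklEval hx z p 0 r ψ g = MvPolynomial.eval (Sum.elim z fun i => p (g⁻¹ i)) r * ψ g := by
  induction r using MvPolynomial.induction_on generalizing ψ with
  | C c => simp
  | add f g hf hg => rw [map_add, LinearMap.add_apply, Pi.add_apply, hf, hg, map_add, add_mul]
  | mul_X f i hf =>
    rw [map_mul, Module.End.mul_apply, hf, map_mul, eval_X, mul_assoc]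
    congr 1
    rcases i with i | i
    · simp [dunklEval_inl]
    · simp [dunklEval_inr, dunkl_apply]

lemma eq_zero_of_eval_injective (r : Rzl N)
    (h : ∀ x : Fin N → ℂ, Function.Injective x → ∀ p : Fin N → ℂ,
      MvPolynomial.eval (Sum.elim x p) r = 0) : r = 0 := by
  have hprod : r * ∏ a ∈ (Finset.univ : Finset (Fin N)).offDiag,
      (X (Sum.inl a.1) - X (Sum.inl a.2)) = 0 := by
    refine MvPolynomial.funext fun y => ?_
    rw [map_mul, map_zero]
    by_cases hy : Function.Injective (y ∘ Sum.inl)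
    · have := h _ hy (y ∘ Sum.inr)
      rw [Sum.elim_comp_inl_inr] at this
      rw [this, zero_mul]
    · simp only [Function.Injective, not_forall] at hy
      obtain ⟨a, b, hab, hne⟩ := hy
      rw [map_prod, Finset.prod_eq_zero (i := (a, b)), mul_zero]
      · simp [hne]
      · simpa [sub_eq_zero] using hab
  refine (mul_eq_zero.1 hprod).resolve_right (Finset.prod_ne_zero_iff.2 fun a ha => ?_)
  rw [sub_ne_zero]
  intro e
  exact (Finset.mem_offDiag.1 ha).2.2 (Sum.inl_injective (X_injective e))

lemma eq_zero_of_bethePsi_eq_zero (F : V1 N)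
    (hF : ∀ (x : Fin N → ℂ) (hx : Function.Injective x) (p : Fin N → ℂ), bethePsi hx p F = 0) :
    F = 0 := by
  let D := Finset.univ.sup fun τ => (lambdaScale (F τ)).natDegree
  have hD : ∀ τ, (lambdaScale (F τ)).natDegree ≤ D := fun τ =>
    Finset.le_sup (f := fun τ => (lambdaScale (F τ)).natDegree) (Finset.mem_univ τ)
  have hlead : ∀ (x : Fin N → ℂ) (hx : Function.Injective x) (p : Fin N → ℂ),
      ∑ τ, dunklEval hx x p 0 ((lambdaScale (F τ)).coeff D) (Pi.single τ 1) = 0 := by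
    intro x hx p
    have hcont : Continuous fun h : ℂ => ∑ τ, ∑ k ∈ Finset.range (D + 1), h ^ (D - k) •
        dunklEval hx x p h ((lambdaScale (F τ)).coeff k) (Pi.single τ 1) := by
      refine continuous_finsetSum _ fun τ _ => continuous_finsetSum _ fun k _ => ?_
      exact (continuous_pow _).smul (continuous_dunklEval hx x (fun _ => p) (fun h => h)
        continuous_const continuous_id _ _ continuous_const)
    have hzero := congrFun (Continuous.ext_on (dense_eval_ne_zero Polynomial.X_ne_zero) hcont
      (continuous_const (y := 0)) fun h hh => ?_) 0
    · refine Eq.trans ?_ hzero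
      refine Finset.sum_congr rfl fun τ _ => ?_
      rw [Finset.sum_eq_single D]
      · simp
      · intro k hk hkD
        have : D - k ≠ 0 := by
          have := Finset.mem_range.1 hk
          omega
        rw [zero_pow this, zero_smul]
      · simp
    · have hh0 : h ≠ 0 := by simpa using hh
      have := hF x hx (h⁻¹ • p)
      rw [bethePsi_apply] at this
      rw [← smul_zero (h ^ D), ← this, Finset.smul_sum]
      refine Finset.sum_congr rfl fun τ _ => ?_
      rw [dunklEval_scale hx x p h⁻¹ (inv_ne_zero hh0), inv_inv,
        Polynomial.eval_eq_sum_range' (Nat.lt_succ_of_le (hD τ)), map_sum, LinearMap.sum_apply,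
        Finset.smul_sum]
      refine Finset.sum_congr rfl fun k hk => ?_
      have hk' : k ≤ D := Nat.lt_succ_iff.1 (Finset.mem_range.1 hk)
      rw [← map_pow, mul_comm, map_mul, dunklEval_C, Module.End.mul_apply,
        Module.algebraMap_end_apply, smul_smul]
      congr 1
      rw [pow_sub₀ _ hh0 hk', inv_pow]
  have hcoeff : ∀ τ, (lambdaScale (F τ)).coeff D = 0 := by
    intro τ
    refine eq_zero_of_eval_injective _ fun x hx p => ?_
    have := congrFun (hlead x hx (p ∘ τ)) τ
    rw [Finset.sum_apply, Finset.sum_eq_single τ] at this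
    · simpa [dunklEval_zero] using this
    · intro τ' _ hne
      rw [dunklEval_zero, Pi.single_eq_of_ne hne.symm, mul_zero]
    · simp
  have hD0 : D = 0 := by
    obtain ⟨τ, -, hτ⟩ := Finset.exists_mem_eq_sup (Finset.univ : Finset (Equiv.Perm (Fin N)))
      Finset.univ_nonempty fun τ => (lambdaScale (F τ)).natDegree
    have h0 : lambdaScale (F τ) = 0 := by
      rw [← Polynomial.leadingCoeff_eq_zero, Polynomial.leadingCoeff, ← hτ]
      exact hcoeff τ
    have : D = (lambdaScale (F τ)).natDegree := hτ
    rw [this, h0, Polynomial.natDegree_zero]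
  funext τ
  rw [← lambdaScale_eval_one (F τ), Polynomial.eq_C_of_natDegree_le_zero ((hD τ).trans hD0.le),
    ← hD0, hcoeff]
  simp

end Injectivity

section Regular
variable {N : ℕ}

lemma exists_eq_vecMulVec_of_rank_eq_one {K : Mat N} (hK : K.rank = 1) :
    ∃ a b : Fin N → ℂ, K = Matrix.vecMulVec a b := by
  obtain ⟨v, -, hv⟩ := finrank_eq_one_iff'.1 hK
  choose c hc using fun j => hv ⟨K.mulVecLin (Pi.single j 1), LinearMap.mem_range_self _ _⟩
  refine ⟨v, c, Matrix.ext fun i j => ?_⟩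
  have := congrFun (congrArg Subtype.val (hc j)) i
  simp only [Matrix.mulVecLin_apply, Matrix.mulVec_single_one] at this
  rw [Matrix.vecMulVec_apply, mul_comm]
  exact this.symm

lemma mcoeff_conj {U U' : Mat N} (hU : U * U' = 1) (i j : Fin (N + 1)) (Z Λ : Mat N) :
    mcoeff N i j (U * Z * U') (U * Λ * U') = mcoeff N i j Z Λ := by
  have hU' : U' * U = 1 := mul_eq_one_comm.1 hU
  have : cmPoly (U * Z * U') (U * Λ * U') = cmPoly Z Λ := by
    refine bivariate_ext Set.univ Set.infinite_univ fun u _ v => ?_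
    rw [cmPoly_eval, cmPoly_eval]
    have key : ∀ (c : ℂ) (A : Mat N), c • (1 : Mat N) - U * A * U' = U * (c • 1 - A) * U' := by
      intro c A
      rw [mul_sub, sub_mul, mul_smul_comm, mul_one, smul_mul_assoc, hU]
    have h2 : (v • (1 : Mat N) - U * Λ * U') * (u • 1 - U * Z * U') - 1
        = U * ((v • (1 : Mat N) - Λ) * (u • 1 - Z) - 1) * U' := by
      rw [key, key]
      generalize v • (1 : Mat N) - Λ = A
      generalize u • (1 : Mat N) - Z = B
      rw [Matrix.mul_sub U, Matrix.sub_mul _ _ U', Matrix.mul_one U, hU]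
      congr 1
      simp only [Matrix.mul_assoc]
      rw [← Matrix.mul_assoc U' U, hU', one_mul]
    rw [h2, Matrix.det_mul_right_comm, hU, one_mul]
  rw [mcoeff, mcoeff, this]

lemma diagonal_cmLax_mem_XN (hN : 0 < N) {x : Fin N → ℂ} (hx : Function.Injective x)
    (p : Fin N → ℂ) : (Matrix.diagonal x, cmLax x p 1) ∈ XN N := by
  have h1 : (1 : Mat N) + Matrix.diagonal x * cmLax x p 1 - cmLax x p 1 * Matrix.diagonal x
      = Matrix.vecMulVec 1 1 := by
    ext i j
    rcases eq_or_ne i j with rfl | hij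
    · simp [cmLax, mul_comm]
    · have : x i - x j ≠ 0 := sub_ne_zero.2 (hx.ne hij)
      simp only [cmLax, one_smul, Matrix.sub_apply, Matrix.add_apply, Matrix.diagonal_mul,
        Matrix.mul_diagonal, Matrix.of_apply, Matrix.diagonal_apply_ne _ hij,
        Matrix.one_apply_ne hij, Matrix.vecMulVec_apply, Pi.one_apply]
      field_simp
      ring
  change Matrix.rank _ = 1
  rw [h1]
  refine le_antisymm (Matrix.rank_vecMulVec_le _ _) (Nat.one_le_iff_ne_zero.2 fun h0 => ?_)
  rw [Matrix.rank, Submodule.finrank_eq_zero, LinearMap.range_eq_bot] at h0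
  simpa using congrFun (LinearMap.congr_fun h0 (Pi.single ⟨0, hN⟩ 1)) ⟨0, hN⟩

lemma exists_conj_diagonal {Z : Mat N} (hZ : N ≤ Z.charpoly.roots.toFinset.card) :
    ∃ (x : Fin N → ℂ) (_ : Function.Injective x) (U U' : Mat N),
      U * U' = 1 ∧ Z = U * Matrix.diagonal x * U' := by
  obtain ⟨S, hS, hcard⟩ := Finset.exists_subset_card_eq hZ
  let e := (S.equivFinOfCardEq hcard).symm
  let x : Fin N → ℂ := fun i => e i
  have hx : Function.Injective x := Subtype.val_injective.comp e.injective
  have hv : ∀ i, ∃ v : Fin N → ℂ, v ≠ 0 ∧ Z.mulVec v = x i • v := by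
    intro i
    have hr : x i ∈ Z.charpoly.roots := Multiset.mem_toFinset.1 (hS (e i).2)
    have h0 : Z.charpoly.eval (x i) = 0 := (Polynomial.mem_roots'.1 hr).2
    rw [Matrix.eval_charpoly] at h0
    obtain ⟨v, hv, h⟩ := Matrix.exists_mulVec_eq_zero_iff.2 h0
    refine ⟨v, hv, ?_⟩
    rw [Matrix.sub_mulVec, sub_eq_zero] at h
    rw [← h]
    simp [Matrix.scalar_apply, ← Matrix.smul_one_eq_diagonal, Matrix.smul_mulVec]
  choose v hv0 hv using hv
  have hli : LinearIndependent ℂ v :=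
    Module.End.eigenvectors_linearIndependent' (Matrix.toLin' Z) x hx v fun i =>
      ⟨Module.End.mem_eigenspace_iff.2 (by simpa using hv i), hv0 i⟩
  let U : Mat N := Matrix.of fun a i => v i a
  have hU : IsUnit U := Matrix.linearIndependent_cols_iff_isUnit.1 hli
  obtain ⟨U', hU'⟩ := hU.exists_right_inv
  refine ⟨x, hx, U, U', hU', ?_⟩
  have hZU : Z * U = U * Matrix.diagonal x := by
    ext a i
    have := congrFun (hv i) a
    simp only [Matrix.mulVec, dotProduct, Pi.smul_apply, smul_eq_mul] at this
    rw [Matrix.mul_apply, Matrix.mul_diagonal]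
    simp only [U, Matrix.of_apply]
    rw [this, mul_comm]
  rw [← hZU, Matrix.mul_assoc, hU', Matrix.mul_one]

lemma exists_conj_cmLax {Z Λ : Mat N} (h : (Z, Λ) ∈ XN N)
    (hZ : N ≤ Z.charpoly.roots.toFinset.card) :
    ∃ (x : Fin N → ℂ) (_ : Function.Injective x) (p : Fin N → ℂ) (U U' : Mat N),
      U * U' = 1 ∧ Z = U * Matrix.diagonal x * U' ∧ Λ = U * cmLax x p 1 * U' := by
  obtain ⟨x, hx, U, U', hU, rfl⟩ := exists_conj_diagonal hZ
  have hU' : U' * U = 1 := mul_eq_one_comm.1 hU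
  let L := U' * Λ * U
  obtain ⟨a, b, hab⟩ := exists_eq_vecMulVec_of_rank_eq_one h
  let a' := U'.mulVec a
  let b' := Matrix.vecMul b U
  have hK : 1 + Matrix.diagonal x * L - L * Matrix.diagonal x = Matrix.vecMulVec a' b' := by
    have h1 : U' * Matrix.vecMulVec a b * U = Matrix.vecMulVec a' b' := by
      rw [Matrix.mul_vecMulVec, Matrix.vecMulVec_mul]
    rw [← h1, ← hab]
    simp only [L, mul_add, mul_sub, add_mul, sub_mul, ← Matrix.mul_assoc, mul_one, hU', one_mul]
    simp only [Matrix.mul_assoc, hU', mul_one]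
  have hentry : ∀ i j, (1 : Mat N) i j + (x i - x j) * L i j = a' i * b' j := by
    intro i j
    have := congrFun (congrFun hK i) j
    rw [Matrix.sub_apply, Matrix.add_apply, Matrix.diagonal_mul, Matrix.mul_diagonal,
      Matrix.vecMulVec_apply] at this
    rw [← this]
    ring
  have hone : ∀ i, a' i * b' i = 1 := fun i => by simpa using (hentry i i).symm
  have hD : Matrix.diagonal a' * Matrix.diagonal b' = (1 : Mat N) := by
    rw [Matrix.diagonal_mul_diagonal, ← Matrix.diagonal_one]
    exact congrArg _ (funext hone)
  have hL : L = Matrix.diagonal a' * cmLax x (fun i => L i i) 1 * Matrix.diagonal b' := by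
    ext i j
    rw [Matrix.mul_diagonal, Matrix.diagonal_mul]
    rcases eq_or_ne i j with rfl | hij
    · simp only [cmLax, Matrix.add_apply, Matrix.diagonal_apply_eq, Matrix.smul_apply,
        Matrix.of_apply, sub_self, inv_zero, smul_zero, add_zero]
      rw [mul_right_comm, hone, one_mul]
    · have : x i - x j ≠ 0 := sub_ne_zero.2 (hx.ne hij)
      have h2 := hentry i j
      rw [Matrix.one_apply_ne hij, zero_add] at h2
      simp only [cmLax, one_smul, Matrix.add_apply, Matrix.of_apply,
        Matrix.diagonal_apply_ne _ hij, zero_add]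
      field_simp
      linear_combination h2
  refine ⟨x, hx, fun i => L i i, U * Matrix.diagonal a', Matrix.diagonal b' * U', ?_, ?_, ?_⟩
  · rw [Matrix.mul_assoc, ← Matrix.mul_assoc _ _ U', hD, one_mul, hU]
  · have : Matrix.diagonal a' * Matrix.diagonal x * Matrix.diagonal b' = Matrix.diagonal x := by
      rw [Matrix.diagonal_mul_diagonal, Matrix.diagonal_mul_diagonal]
      congr 1
      funext i
      rw [mul_right_comm, hone, one_mul]
    refine (congrArg (U * · * U') this.symm).trans ?_
    simp only [Matrix.mul_assoc]
  · have : U * L * U' = Λ := by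
      simp only [L, ← Matrix.mul_assoc, hU, one_mul]
      rw [Matrix.mul_assoc, hU, mul_one]
    refine this.symm.trans ((congrArg (U * · * U') hL).trans ?_)
    simp only [Matrix.mul_assoc]

end Regular

section FirstOrder
variable {N : ℕ}

/-- The matrix `Z + εQ` over the dual numbers. -/
def dualMat (Z Q : Mat N) : Matrix (Fin N) (Fin N) (DualNumber ℂ) :=
  Z.map TrivSqZeroExt.inl + Q.map TrivSqZeroExt.inr

lemma dualMat_mul (Z Q Z' Q' : Mat N) :
    dualMat Z Q * dualMat Z' Q' = dualMat (Z * Z') (Z * Q' + Q * Z') := by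
  ext i j
  · simp [dualMat, Matrix.mul_apply, TrivSqZeroExt.fst_sum]
  · simp [dualMat, Matrix.mul_apply, TrivSqZeroExt.snd_sum, Finset.sum_add_distrib, mul_comm]

lemma exists_dualMat_pow (Z Q : Mat N) (k : ℕ) :
    ∃ D : Mat N, dualMat Z Q ^ k = dualMat (Z ^ k) D ∧
      ∀ j, (D * Z ^ j).trace = k * (Z ^ (k - 1 + j) * Q).trace := by
  induction k with
  | zero =>
    refine ⟨0, ?_, by simp⟩
    ext i j <;> rcases eq_or_ne i j with rfl | hij <;> simp [dualMat, *]
  | succ k ih =>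
    obtain ⟨D, hD, hj⟩ := ih
    refine ⟨Z ^ k * Q + D * Z, by rw [pow_succ, hD, dualMat_mul, ← pow_succ], fun j => ?_⟩
    have h1 : (Z ^ k * Q * Z ^ j).trace = (Z ^ (k + j) * Q).trace := by
      rw [Matrix.trace_mul_comm, ← Matrix.mul_assoc, ← pow_add, add_comm]
    rw [add_mul, Matrix.trace_add, h1, Matrix.mul_assoc, ← pow_succ', hj]
    rcases k with _ | k
    · simp
    · rw [show k + 1 - 1 + (j + 1) = k + 1 + j by omega,
        show k + 1 + 1 - 1 + j = k + 1 + j by omega]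
      push_cast
      ring

lemma trace_aeval_dualMat (Z Q : Mat N) (f : Polynomial ℂ) :
    (Polynomial.aeval (dualMat Z Q) f).trace
      = TrivSqZeroExt.inl (Polynomial.aeval Z f).trace
        + TrivSqZeroExt.inr (Polynomial.aeval Z (Polynomial.derivative f) * Q).trace := by
  induction f using Polynomial.induction_on' with
  | add f g hf hg =>
    simp only [map_add, Matrix.trace_add, hf, hg, add_mul, TrivSqZeroExt.inl_add,
      TrivSqZeroExt.inr_add]
    abel
  | monomial k c =>
    obtain ⟨D, hD, hj⟩ := exists_dualMat_pow Z Q k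
    have h0 := hj 0
    rw [pow_zero, mul_one, add_zero] at h0
    rw [Polynomial.derivative_monomial, Polynomial.aeval_monomial, Polynomial.aeval_monomial,
      Polynomial.aeval_monomial, hD, ← Algebra.smul_def, ← Algebra.smul_def, ← Algebra.smul_def,
      Matrix.trace_smul, Matrix.trace_smul, smul_mul_assoc, Matrix.trace_smul, mul_smul,
      smul_eq_mul (a := (k : ℂ)), ← h0]
    ext <;> simp [dualMat, Matrix.trace, TrivSqZeroExt.fst_sum, TrivSqZeroExt.snd_sum]

lemma det_trace_aeval_dualMat_eq_zero {ι : Type*} [Fintype ι] [DecidableEq ι] (Z Q : Mat N)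
    (hs : {s : ℂ | (Z + s • Q).charpoly.roots.toFinset.card < Fintype.card ι}.Infinite)
    (f g : ι → Polynomial ℂ) :
    (Matrix.of fun a b => (Polynomial.aeval (dualMat Z Q) (f a * g b)).trace).det = 0 := by
  let A : Matrix (Fin N) (Fin N) (Polynomial ℂ) :=
    Z.map Polynomial.C + (Polynomial.X : Polynomial ℂ) • Q.map Polynomial.C
  let D : Polynomial ℂ :=
    (Matrix.of fun a b => (Polynomial.aeval A (f a * g b)).trace).det
  have hmap : ∀ {S : Type} [CommRing S] [Algebra ℂ S] (ψ : Polynomial ℂ →ₐ[ℂ] S),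
      ψ D = (Matrix.of fun a b =>
        (Polynomial.aeval (ψ.mapMatrix A) (f a * g b)).trace).det := by
    intro S _ _ ψ
    rw [AlgHom.map_det]
    congr 1
    ext a b
    simp only [AlgHom.mapMatrix_apply, Matrix.map_apply, Matrix.of_apply]
    rw [AddMonoidHom.map_trace, ← AlgHom.mapMatrix_apply ψ A, Polynomial.aeval_algHom_apply,
      AlgHom.mapMatrix_apply]
  have hD : D = 0 := by
    refine Polynomial.eq_zero_of_infinite_isRoot _ (hs.mono fun s hs => ?_)
    have hA : (Polynomial.aeval s).mapMatrix A = Z + s • Q := by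
      ext i j
      simp [A, mul_comm s]
    have := hmap (Polynomial.aeval s)
    rw [hA, det_trace_aeval_eq_zero _ hs] at this
    simpa using this
  have hA : (Polynomial.aeval (DualNumber.eps : DualNumber ℂ)).mapMatrix A = dualMat Z Q := by
    ext i j <;> simp [A, dualMat, TrivSqZeroExt.algebraMap_eq_inl]
  rw [← hA, ← hmap, hD, map_zero]

end FirstOrder

section Projectors
variable {N : ℕ}

/-- `φ` is a polynomial whose value at `Z` is the spectral projector of the eigenvalue `ξ`. -/
structure IsSpectralPoly (Z : Mat N) (ξ : ℂ) (φ : Polynomial ℂ) : Prop where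
  eval_self : φ.eval ξ = 1
  eval_of_ne : ∀ η ∈ Z.charpoly.roots.toFinset, η ≠ ξ → φ.eval η = 0
  idem : Polynomial.aeval Z φ * Polynomial.aeval Z φ = Polynomial.aeval Z φ
  aeval_derivative : Polynomial.aeval Z (Polynomial.derivative φ) = 0

lemma aeval_eq_zero_of_pow_dvd (Z : Mat N) (f : Polynomial ℂ)
    (hf : ∀ ξ ∈ Z.charpoly.roots.toFinset, (Polynomial.X - Polynomial.C ξ) ^ N ∣ f) :
    Polynomial.aeval Z f = 0 := by
  have h1 : Z.charpoly ∣ f := by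
    rw [(IsAlgClosed.splits Z.charpoly).eq_prod_roots_of_monic Z.charpoly_monic,
      Finset.prod_multiset_map_count]
    refine Finset.prod_dvd_of_coprime (fun a _ b _ hab => ?_) fun ξ hξ => ?_
    · exact (Polynomial.pairwise_coprime_X_sub_C Function.injective_id hab).pow
    · refine (pow_dvd_pow _ ?_).trans (hf ξ hξ)
      refine (Multiset.count_le_card _ _).trans ((Polynomial.card_roots' _).trans ?_)
      rw [Matrix.charpoly_natDegree_eq_dim, Fintype.card_fin]
  obtain ⟨g, rfl⟩ := h1
  rw [map_mul, Matrix.aeval_self_charpoly, zero_mul]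

lemma pow_dvd_derivative_of_pow_succ_dvd {p f : Polynomial ℂ} {n : ℕ} (h : p ^ (n + 1) ∣ f) :
    p ^ n ∣ Polynomial.derivative f := by
  obtain ⟨g, rfl⟩ := h
  rw [Polynomial.derivative_mul, Polynomial.derivative_pow_succ, pow_succ]
  exact dvd_add ⟨Polynomial.C (n + 1 : ℂ) * Polynomial.derivative p * g, by ring⟩
    ⟨p * Polynomial.derivative g, by ring⟩

lemma exists_isSpectralPoly (Z : Mat N) (ξ : ℂ) : ∃ φ, IsSpectralPoly Z ξ φ := by
  let χ : Polynomial ℂ := ∏ η ∈ Z.charpoly.roots.toFinset.erase ξ,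
    (Polynomial.X - Polynomial.C η) ^ (N + 1)
  obtain ⟨a, b, hab⟩ : IsCoprime ((Polynomial.X - Polynomial.C ξ) ^ (N + 1)) χ := by
    refine IsCoprime.prod_right fun η hη => IsCoprime.pow ?_
    exact Polynomial.pairwise_coprime_X_sub_C Function.injective_id (Finset.ne_of_mem_erase hη).symm
  have hχ : ∀ η ∈ Z.charpoly.roots.toFinset, η ≠ ξ →
      (Polynomial.X - Polynomial.C η) ^ (N + 1) ∣ χ := fun η hη hne =>
    Finset.dvd_prod_of_mem (fun η => (Polynomial.X - Polynomial.C η) ^ (N + 1))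
      (Finset.mem_erase.2 ⟨hne, hη⟩)
  have h1 : (1 : Polynomial ℂ) - b * χ = a * (Polynomial.X - Polynomial.C ξ) ^ (N + 1) := by
    rw [← hab]; ring
  refine ⟨b * χ, ⟨?_, fun η hη hne => ?_, ?_, ?_⟩⟩
  · have := congrArg (Polynomial.eval ξ) h1
    simp only [Polynomial.eval_sub, Polynomial.eval_one, Polynomial.eval_mul (p := a),
      Polynomial.eval_pow, Polynomial.eval_X, Polynomial.eval_C, sub_self, ne_eq,
      Nat.succ_ne_zero, not_false_eq_true, zero_pow, mul_zero] at this
    exact (sub_eq_zero.1 this).symm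
  · obtain ⟨c, hc⟩ := hχ η hη hne
    rw [hc]
    simp
  · have : Polynomial.aeval Z (b * χ * (1 - b * χ)) = 0 := by
      refine aeval_eq_zero_of_pow_dvd Z _ fun η hη => (pow_dvd_pow _ N.le_succ).trans ?_
      rcases eq_or_ne η ξ with rfl | hne
      · rw [h1]
        exact (dvd_mul_left _ _).mul_left _
      · exact ((hχ η hη hne).mul_left _).mul_right _
    rw [mul_sub, mul_one, map_sub, map_mul _ (b * χ) (b * χ), sub_eq_zero] at this
    exact this.symm
  · refine aeval_eq_zero_of_pow_dvd Z _ fun η hη => ?_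
    rcases eq_or_ne η ξ with rfl | hne
    · have : Polynomial.derivative (b * χ) = -Polynomial.derivative (1 - b * χ) := by simp
      rw [this, h1]
      exact (pow_dvd_derivative_of_pow_succ_dvd (dvd_mul_left _ _)).neg_right
    · exact pow_dvd_derivative_of_pow_succ_dvd ((hχ η hη hne).mul_left _)

lemma IsSpectralPoly.trace_ne_zero {Z : Mat N} {ξ : ℂ} {φ : Polynomial ℂ}
    (h : IsSpectralPoly Z ξ φ) (hξ : ξ ∈ Z.charpoly.roots.toFinset) :
    (Polynomial.aeval Z φ).trace ≠ 0 := by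
  intro h0
  have hid : IsIdempotentElem (Matrix.toLin' (Polynomial.aeval Z φ)) := by
    rw [IsIdempotentElem, Module.End.mul_eq_comp, ← Matrix.toLin'_mul, h.idem]
  have hP : Polynomial.aeval Z φ = 0 := by
    have := (LinearMap.IsIdempotentElem.trace_eq_zero_iff hid).1
      (by rw [Matrix.trace_toLin'_eq]; exact h0)
    simpa using this
  have hr : ξ ∈ spectrum ℂ Z := Matrix.mem_spectrum_iff_isRoot_charpoly.2
    (Polynomial.mem_roots'.1 (Multiset.mem_toFinset.1 hξ)).2
  have := spectrum.subset_polynomial_aeval Z φ ⟨ξ, hr, rfl⟩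
  beta_reduce at this
  rw [hP, h.eval_self, spectrum.mem_iff, map_one, sub_zero] at this
  exact this isUnit_one

lemma sum_trace_spectralPoly {Z : Mat N} {φ : ℂ → Polynomial ℂ}
    (h : ∀ ξ, IsSpectralPoly Z ξ (φ ξ)) :
    ∑ ξ ∈ Z.charpoly.roots.toFinset, (Polynomial.aeval Z (φ ξ)).trace = N := by
  have := trace_aeval_eq_zero_of_roots Z (∑ ξ ∈ Z.charpoly.roots.toFinset, φ ξ - 1) (by
    intro η hη
    rw [Polynomial.eval_sub, Polynomial.eval_finsetSum, Polynomial.eval_one,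
      Finset.sum_eq_single_of_mem η (Multiset.mem_toFinset.2 hη), (h η).eval_self, sub_self]
    intro ξ _ hne
    exact (h ξ).eval_of_ne η (Multiset.mem_toFinset.2 hη) hne.symm)
  rw [map_sub, map_sum, map_one, Matrix.trace_sub, Matrix.trace_sum, Matrix.trace_one,
    Fintype.card_fin, sub_eq_zero] at this
  exact this

end Projectors

section Maximal
variable {N : ℕ}

/-- If the number of eigenvalues of `Z + sQ` does not exceed that of `Z` for infinitely many `s`,
then the products of polynomials vanishing on the spectrum of `Z` have zero first variation. -/
lemma trace_derivative_mul_eq_zero (Z Q : Mat N)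
    (hs : {s : ℂ | (Z + s • Q).charpoly.roots.toFinset.card
      ≤ Z.charpoly.roots.toFinset.card}.Infinite)
    (f g : Polynomial ℂ) (hf : ∀ ξ ∈ Z.charpoly.roots, f.eval ξ = 0)
    (hg : ∀ ξ ∈ Z.charpoly.roots, g.eval ξ = 0) :
    (Polynomial.aeval Z (Polynomial.derivative (f * g)) * Q).trace = 0 := by
  choose φ hφ using exists_isSpectralPoly Z
  let T : Polynomial ℂ → DualNumber ℂ := fun f => (Polynomial.aeval (dualMat Z Q) f).trace
  let S := {ξ // ξ ∈ Z.charpoly.roots.toFinset}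
  have hdet := det_trace_aeval_dualMat_eq_zero (ι := S ⊕ Unit) Z Q
    (hs.mono fun s hs => by simpa [S, Nat.lt_succ_iff] using hs)
    (Sum.elim (fun ξ => φ ξ) fun _ => f) (Sum.elim (fun ξ => φ ξ) fun _ => g)
  let A : Matrix S S (DualNumber ℂ) := Matrix.of fun a b => T (φ a * φ b)
  let B : Matrix S Unit (DualNumber ℂ) := Matrix.of fun a _ => T (φ a * g)
  let C : Matrix Unit S (DualNumber ℂ) := Matrix.of fun _ b => T (f * φ b)
  let D : Matrix Unit Unit (DualNumber ℂ) := Matrix.of fun _ _ => T (f * g)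
  have hblock : (Matrix.of fun a b : S ⊕ Unit => (Polynomial.aeval (dualMat Z Q)
      ((Sum.elim (fun ξ : S => φ ξ) fun _ => f) a * (Sum.elim (fun ξ : S => φ ξ) fun _ => g) b)).trace)
      = Matrix.fromBlocks A B C D := by
    ext a b <;> rcases a with a | a <;> rcases b with b | b <;> rfl
  have hT : ∀ f, (T f).fst = (Polynomial.aeval Z f).trace := fun f => by
    simp [T, trace_aeval_dualMat]
  have hB : ∀ a b, (B a b).fst = 0 := fun a b => by
    refine (hT _).trans ?_
    exact trace_aeval_eq_zero_of_roots Z _ fun ξ hξ => by simp [hg ξ hξ]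
  have hC : ∀ a b, (C a b).fst = 0 := fun a b => by
    refine (hT _).trans ?_
    exact trace_aeval_eq_zero_of_roots Z _ fun ξ hξ => by simp [hf ξ hξ]
  have hA : IsUnit A.det := by
    rw [TrivSqZeroExt.isUnit_iff_isUnit_fst, isUnit_iff_ne_zero]
    have : A.det.fst = (Matrix.diagonal fun a : S => (Polynomial.aeval Z (φ a)).trace).det := by
      rw [← TrivSqZeroExt.fstHom_apply ℂ, AlgHom.map_det]
      congr 1
      ext a b
      rw [AlgHom.mapMatrix_apply, Matrix.map_apply, TrivSqZeroExt.fstHom_apply]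
      refine (hT _).trans ?_
      rcases eq_or_ne a b with rfl | hab
      · rw [Matrix.diagonal_apply_eq, map_mul, (hφ a).idem]
      · rw [Matrix.diagonal_apply_ne _ hab]
        refine trace_aeval_eq_zero_of_roots Z _ fun ξ hξ => ?_
        rw [Polynomial.eval_mul]
        have hξ' := Multiset.mem_toFinset.2 hξ
        rcases eq_or_ne ξ a with rfl | hne
        · rw [(hφ b).eval_of_ne _ hξ' fun e => hab (Subtype.ext e), mul_zero]
        · rw [(hφ a).eval_of_ne _ hξ' hne, zero_mul]
    rw [this, Matrix.det_diagonal]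
    exact Finset.prod_ne_zero_iff.2 fun a _ => (hφ a).trace_ne_zero a.2
  let _ := Matrix.invertibleOfIsUnitDet A hA
  rw [hblock, Matrix.det_fromBlocks₁₁] at hdet
  have hD := hA.mul_right_eq_zero.1 hdet
  have hCB : C * ⅟A * B = 0 := by
    have hinr : ∀ t : DualNumber ℂ, t.fst = 0 → t = TrivSqZeroExt.inr t.snd := fun t ht => by
      ext <;> simp [ht]
    ext a b : 1
    rw [Matrix.mul_apply]
    refine Finset.sum_eq_zero fun c _ => ?_
    have : ((C * ⅟A) a c).fst = 0 := by
      rw [Matrix.mul_apply, TrivSqZeroExt.fst_sum]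
      exact Finset.sum_eq_zero fun d _ => by rw [TrivSqZeroExt.fst_mul, hC, zero_mul]
    rw [hinr _ this, hinr _ (hB c b), TrivSqZeroExt.inr_mul_inr]
  rw [hCB, sub_zero, Matrix.det_unique] at hD
  change T (f * g) = 0 at hD
  have := congrArg TrivSqZeroExt.snd hD
  simpa [T, trace_aeval_dualMat] using this

lemma IsSpectralPoly.aeval_derivative_pow {Z : Mat N} {ξ : ℂ} {φ : Polynomial ℂ}
    (h : IsSpectralPoly Z ξ φ) (j : ℕ) :
    Polynomial.aeval Z (Polynomial.derivative
      ((Polynomial.X - Polynomial.C ξ) * φ * ((Polynomial.X - Polynomial.C ξ) ^ j * φ)))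
      = (j + 1 : ℂ) • ((Z - ξ • 1) ^ j * Polynomial.aeval Z φ) := by
  have h1 : Polynomial.derivative
      ((Polynomial.X - Polynomial.C ξ) * φ * ((Polynomial.X - Polynomial.C ξ) ^ j * φ))
      = Polynomial.C (j + 1 : ℂ) * ((Polynomial.X - Polynomial.C ξ) ^ j * (φ * φ))
        + 2 * (Polynomial.X - Polynomial.C ξ) ^ (j + 1) * φ * Polynomial.derivative φ := by
    rw [show (Polynomial.X - Polynomial.C ξ) * φ * ((Polynomial.X - Polynomial.C ξ) ^ j * φ)
      = (Polynomial.X - Polynomial.C ξ) ^ (j + 1) * (φ * φ) by ring, Polynomial.derivative_mul,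
      Polynomial.derivative_X_sub_C_pow, Polynomial.derivative_mul]
    push_cast
    simp only [map_add, map_one, map_natCast]
    ring
  rw [h1, map_add, map_mul _ _ (Polynomial.derivative φ), h.aeval_derivative, mul_zero, add_zero]
  simp only [map_mul, map_pow, map_sub, Polynomial.aeval_C, Polynomial.aeval_X, h.idem,
    Algebra.algebraMap_eq_smul_one, smul_mul_assoc, one_mul]

lemma add_smul_pow_three {A : Type*} [Ring A] [Algebra ℂ A] (c : ℂ) (L E : A) :
    (L + c • E) ^ 3 = L ^ 3 + c • (E * L * L + L * E * L + L * L * E)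
      + c ^ 2 • (E * E * L + E * L * E + L * E * E) + c ^ 3 • E ^ 3 := by
  simp only [pow_succ, pow_zero, one_mul, mul_add, add_mul, smul_mul_assoc, mul_smul_comm,
    smul_add, smul_smul, ← mul_assoc]
  abel

lemma add_smul_mul_sub_mul_add_smul {A : Type*} [Ring A] [Algebra ℂ A] (c : ℂ) (Z L E : A)
    (h : E * L = L * E) : 1 + (Z + c • E) * L - L * (Z + c • E) = 1 + Z * L - L * Z := by
  rw [add_mul, mul_add, smul_mul_assoc, mul_smul_comm, h]
  abel

lemma mul_add_smul_sub_add_smul_mul {A : Type*} [Ring A] [Algebra ℂ A] (c : ℂ) (Z L E : A)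
    (h : Z * E = E * Z) : 1 + Z * (L + c • E) - (L + c • E) * Z = 1 + Z * L - L * Z := by
  rw [add_mul, mul_add, smul_mul_assoc, mul_smul_comm, h]
  abel

lemma trace_mul_cube_linear_coeff (M L E : Mat N)
    (h : {c : ℂ | (M * (L + c • E) ^ 3).trace = 0}.Infinite) :
    (M * (E * L * L + L * E * L + L * L * E)).trace = 0 := by
  let q : Polynomial ℂ := Polynomial.C (M * L ^ 3).trace
    + Polynomial.C (M * (E * L * L + L * E * L + L * L * E)).trace * Polynomial.X
    + Polynomial.C (M * (E * E * L + E * L * E + L * E * E)).trace * Polynomial.X ^ 2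
    + Polynomial.C (M * E ^ 3).trace * Polynomial.X ^ 3
  have hq : q = 0 := by
    refine Polynomial.eq_zero_of_infinite_isRoot _ (h.mono fun c hc => ?_)
    have hc : (M * (L + c • E) ^ 3).trace = 0 := hc
    change Polynomial.eval c q = 0
    rw [← hc]
    have := add_smul_pow_three c L E
    rw [this]
    simp only [mul_add M, Matrix.trace_add, mul_smul_comm, Matrix.trace_smul, q,
      Polynomial.eval_add, Polynomial.eval_mul, Polynomial.eval_C, Polynomial.eval_pow,
      Polynomial.eval_X, smul_eq_mul]
    ring
  have := congrArg (Polynomial.coeff · 1) hq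
  simpa [q, Polynomial.coeff_X, Polynomial.coeff_X_pow, Polynomial.coeff_C] using this

/-- `p` maximizes the number of eigenvalues of the first component on `O ∩ X_N`. -/
structure IsMaxSpectrum (O : Set (Mat N × Mat N)) (p : Mat N × Mat N) : Prop where
  mem : p ∈ O
  mem_XN : p ∈ XN N
  card_le : ∀ q ∈ O, q ∈ XN N →
    q.1.charpoly.roots.toFinset.card ≤ p.1.charpoly.roots.toFinset.card

lemma IsMaxSpectrum.trace_eq_zero {O : Set (Mat N × Mat N)} (hO : IsOpen O) {Z L : Mat N}
    (h : IsMaxSpectrum O (Z, L)) {ξ : ℂ} {φ : Polynomial ℂ} (hφ : IsSpectralPoly Z ξ φ)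
    {j : ℕ} (hj : j ≠ 0) (m : ℕ) :
    ((Z - ξ • 1) ^ j * Polynomial.aeval Z φ * L ^ m).trace = 0 := by
  have hcont : Continuous fun s : ℂ => (Z + s • L ^ m, L) := by fun_prop
  have hinf : {s : ℂ | (Z + s • L ^ m).charpoly.roots.toFinset.card
      ≤ Z.charpoly.roots.toFinset.card}.Infinite := by
    refine infinite_of_mem_nhds (0 : ℂ) ?_
    filter_upwards [(hO.preimage hcont).mem_nhds (by simpa using h.mem)] with s hs
    have hs' : (Z + s • L ^ m, L) ∈ O := hs
    have hLm : L ^ m * L = L * L ^ m := by rw [← pow_succ, ← pow_succ']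
    have hX : (Z + s • L ^ m, L) ∈ XN N :=
      (congrArg Matrix.rank (add_smul_mul_sub_mul_add_smul s Z L (L ^ m) hLm)).trans h.mem_XN
    exact h.card_le (Z + s • L ^ m, L) hs' hX
  have hφ0 : ∀ η ∈ Z.charpoly.roots, (η - ξ) * φ.eval η = 0 := fun η hη => by
    rcases eq_or_ne η ξ with rfl | hne
    · rw [sub_self, zero_mul]
    · rw [hφ.eval_of_ne η (Multiset.mem_toFinset.2 hη) hne, mul_zero]
  have := trace_derivative_mul_eq_zero Z (L ^ m) hinf ((Polynomial.X - Polynomial.C ξ) * φ)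
    ((Polynomial.X - Polynomial.C ξ) ^ j * φ) (fun η hη => by simpa using hφ0 η hη)
    (fun η hη => by
      obtain ⟨i, rfl⟩ := Nat.exists_eq_succ_of_ne_zero hj
      rw [pow_succ]
      simp only [Polynomial.eval_mul, Polynomial.eval_pow, Polynomial.eval_sub, Polynomial.eval_X,
        Polynomial.eval_C, mul_assoc, hφ0 η hη, mul_zero])
  rw [hφ.aeval_derivative_pow, smul_mul_assoc, Matrix.trace_smul, smul_eq_mul] at this
  exact (mul_eq_zero.1 this).resolve_left (Nat.cast_add_one_ne_zero j)

lemma IsMaxSpectrum.trace_mul_cube {O : Set (Mat N × Mat N)} (hO : IsOpen O) {Z L : Mat N}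
    (h : IsMaxSpectrum O (Z, L)) {ξ : ℂ} {φ : Polynomial ℂ} (hφ : IsSpectralPoly Z ξ φ)
    {j : ℕ} (hj : j ≠ 0) {E : Mat N} (hE : Commute Z E) :
    ((Z - ξ • 1) ^ j * Polynomial.aeval Z φ * (E * L * L + L * E * L + L * L * E)).trace = 0 := by
  have hcont : Continuous fun c : ℂ => (Z, L + c • E) := by fun_prop
  refine trace_mul_cube_linear_coeff _ _ _ (infinite_of_mem_nhds (0 : ℂ) ?_)
  filter_upwards [(hO.preimage hcont).mem_nhds (by simpa using h.mem)] with c hc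
  exact IsMaxSpectrum.trace_eq_zero hO ⟨hc, (congrArg Matrix.rank
    (mul_add_smul_sub_add_smul_mul c Z L E hE.eq)).trans h.mem_XN, h.card_le⟩ hφ hj 3

lemma trace_mul_vecMulVec_sq (P : Mat N) (a b : Fin N → ℂ) :
    (P * Matrix.vecMulVec a b * (P * Matrix.vecMulVec a b)).trace
      = (P * Matrix.vecMulVec a b).trace * (P * Matrix.vecMulVec a b).trace := by
  rw [Matrix.mul_vecMulVec, Matrix.vecMulVec_mul_vecMulVec, Matrix.trace_vecMulVec,
    Matrix.trace_vecMulVec]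
  simp [dotProduct_comm]

lemma compress_sq {A : Type*} [Ring A] {P n L : A} (hPP : P * P = P) (hPn : P * n = n)
    (hnP : n * P = n) :
    (P + n * L * P - P * L * n) * (P + n * L * P - P * L * n)
      = P + 2 * (n * L * P) - 2 * (P * L * n) + n * L * n * L * P + P * L * n * L * n
        - n * L * P * L * n - P * L * n * n * L * P := by
  have e1 : ∀ x, P * (P * x) = P * x := fun x => by rw [← mul_assoc, hPP]
  have e2 : ∀ x, P * (n * x) = n * x := fun x => by rw [← mul_assoc, hPn]
  have e3 : ∀ x, n * (P * x) = n * x := fun x => by rw [← mul_assoc, hnP]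
  simp only [mul_add, add_mul, mul_sub, sub_mul, mul_assoc, hPP, hnP, e1, e2, e3, two_mul]
  abel

lemma compress_commutator {A : Type*} [Ring A] {P n L Z K c : A} (hPP : P * P = P)
    (hK : K = 1 + Z * L - L * Z) (hPZ : P * Z = c * P + n) (hZP : Z * P = P * Z)
    (hc : ∀ x, c * x = x * c) :
    P * K * P = P + n * L * P - P * L * n := by
  have : P * K * P = P * P + P * Z * L * P - P * L * (Z * P) := by rw [hK]; noncomm_ring
  have hcP : c * P * L * P = P * L * (c * P) := by
    rw [mul_assoc, mul_assoc, hc, hc P, ← mul_assoc, ← mul_assoc]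
  rw [this, hZP, hPZ, hPP, add_mul, add_mul, mul_add (P * L), hcP]
  abel

lemma sq_mul_of_idem_of_comm {A : Type*} [Ring A] {P B : A} (hPP : P * P = P)
    (h : B * P = P * B) : B ^ 2 * P = B * P * (B * P) := by
  rw [mul_assoc, ← mul_assoc P, ← h, mul_assoc, hPP, pow_two, mul_assoc]

lemma trace_compress_sq {P n L : Mat N} (hPP : P * P = P) (hPn : P * n = n) (hnP : n * P = n)
    (h1 : (n * (n * L * L + L * n * L + L * L * n)).trace = 0)
    (h2 : (n * n * (P * L * L + L * P * L + L * L * P)).trace = 0)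
    (h3 : (n * n * L ^ 2).trace = 0) :
    ((P + n * L * P - P * L * n) * (P + n * L * P - P * L * n)).trace = P.trace := by
  rw [compress_sq hPP hPn hnP, two_mul, two_mul]
  have e1 : ∀ x, P * (P * x) = P * x := fun x => by rw [← mul_assoc, hPP]
  have e2 : ∀ x, P * (n * x) = n * x := fun x => by rw [← mul_assoc, hPn]
  have e3 : ∀ x, n * (P * x) = n * x := fun x => by rw [← mul_assoc, hnP]
  simp only [pow_two, Matrix.mul_add, Matrix.trace_add, Matrix.trace_sub, Matrix.mul_assoc,
    e3] at h1 h2 h3 ⊢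
  have t1 : (n * (L * P)).trace = (n * L).trace := by
    rw [← Matrix.mul_assoc, Matrix.trace_mul_comm, e2]
  have t2 : (P * (L * n)).trace = (n * L).trace := by
    rw [← Matrix.mul_assoc, Matrix.trace_mul_comm, e3]
  have t3 : (n * (L * (n * (L * P)))).trace = (n * (L * (n * L))).trace := by
    simpa only [Matrix.mul_assoc, e2] using Matrix.trace_mul_comm (n * (L * (n * L))) P
  have t4 : (P * (L * (n * (L * n)))).trace = (n * (L * (n * L))).trace := by
    simpa only [Matrix.mul_assoc, e1, e2, e3] using Matrix.trace_mul_comm (P * (L * (n * L))) n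
  have t5 : (n * (L * (P * (L * n)))).trace = (n * (n * (L * (P * L)))).trace := by
    simpa only [Matrix.mul_assoc, e1, e2, e3] using Matrix.trace_mul_comm (n * (L * (P * L))) n
  have t6 : (P * (L * (n * (n * (L * P))))).trace = (n * (n * (L * (P * L)))).trace := by
    simpa only [Matrix.mul_assoc, e1, e2, e3] using
      Matrix.trace_mul_comm (P * L) (n * (n * (L * P)))
  have t7 : (n * (L * (L * n))).trace = (n * (n * (L * L))).trace := by
    simpa only [Matrix.mul_assoc, e1, e2, e3] using Matrix.trace_mul_comm (n * (L * L)) n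
  have t8 : (n * (n * (L * (L * P)))).trace = (n * (n * (L * L))).trace := by
    simpa only [Matrix.mul_assoc, e1, e2, e3] using Matrix.trace_mul_comm (n * (n * (L * L))) P
  rw [t1, t2, t3, t4, t5, t6]
  rw [t7, h3] at h1
  rw [t8, h3] at h2
  linear_combination 2 * h1 - 2 * h2

lemma IsMaxSpectrum.trace_projector {O : Set (Mat N × Mat N)} (hO : IsOpen O) {Z L : Mat N}
    (h : IsMaxSpectrum O (Z, L)) {ξ : ℂ} {φ : Polynomial ℂ} (hφ : IsSpectralPoly Z ξ φ) :
    (Polynomial.aeval Z φ).trace * (Polynomial.aeval Z φ).trace = (Polynomial.aeval Z φ).trace := by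
  have h1 := fun j hj (E : Mat N) => h.trace_mul_cube hO hφ (j := j) hj (E := E)
  have h2 := h.trace_eq_zero hO hφ two_ne_zero 2
  obtain ⟨a, b, hab⟩ := exists_eq_vecMulVec_of_rank_eq_one h.mem_XN
  set P := Polynomial.aeval Z φ with hP
  have hPP : P * P = P := hφ.idem
  have hZP : Z * P = P * Z := by
    have := congrArg (Polynomial.aeval Z) (mul_comm Polynomial.X φ)
    simpa using this
  set n := (Z - ξ • 1) * P with hn
  have hnP : n * P = n := by rw [hn, Matrix.mul_assoc, hPP]
  have hcomm : (Z - ξ • 1) * P = P * (Z - ξ • 1) := by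
    rw [Matrix.sub_mul, Matrix.mul_sub, hZP, smul_mul_assoc, mul_smul_comm, one_mul, mul_one]
  have hPn : P * n = n := by
    rw [hn, hcomm, ← Matrix.mul_assoc, hPP]
  have hnn : (Z - ξ • 1) ^ 2 * P = n * n := sq_mul_of_idem_of_comm hPP hcomm
  have hPZ : P * Z = (ξ • (1 : Mat N)) * P + n := by
    rw [hn, Matrix.sub_mul, hZP]
    abel
  have hZn : Commute Z n := by
    rw [hn]
    refine Commute.mul_right ?_ hZP
    exact (Commute.refl Z).sub_right ((Commute.one_right Z).smul_right ξ)
  set K := 1 + Z * L - L * Z with hK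
  have hcomp := compress_commutator hPP hK hPZ hZP fun x => by simp
  have hPK : (P * K).trace = P.trace := by
    rw [hK, Matrix.mul_sub, Matrix.mul_add, Matrix.trace_sub, Matrix.trace_add, mul_one,
      ← Matrix.mul_assoc, ← hZP, ← Matrix.mul_assoc, Matrix.trace_mul_comm (P * L),
      ← Matrix.mul_assoc]
    ring
  have hPKPK : (P * K * (P * K)).trace = (P * K * P * (P * K * P)).trace := by
    have : P * K * P * (P * K * P) = P * K * (P * K) * P := by
      simp only [Matrix.mul_assoc]
      rw [← Matrix.mul_assoc P P, hPP]
    rw [this, Matrix.trace_mul_comm _ P]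
    simp only [← Matrix.mul_assoc, hPP]
  have key := trace_mul_vecMulVec_sq P a b
  rw [← hab] at key
  change (P * K * (P * K)).trace = (P * K).trace * (P * K).trace at key
  rw [hPK] at key
  rw [← key, hPKPK, hcomp]
  have hX1 := h1 1 one_ne_zero n hZn
  have hX2 := h1 2 two_ne_zero P hZP
  rw [pow_one] at hX1
  rw [hnn] at hX2 h2
  exact trace_compress_sq hPP hPn hnP hX1 hX2 h2

end Maximal

section Density
variable {N : ℕ}

/-- Every point of `X_N` is a limit of points of `X_N` whose first component has simple
spectrum. -/
lemma exists_simple_spectrum_mem {O : Set (Mat N × Mat N)} (hO : IsOpen O)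
    {p : Mat N × Mat N} (hp : p ∈ O) (hpX : p ∈ XN N) :
    ∃ q ∈ O, q ∈ XN N ∧ N ≤ q.1.charpoly.roots.toFinset.card := by
  have hle : ∀ Z : Mat N, Z.charpoly.roots.toFinset.card ≤ N := fun Z =>
    (Multiset.toFinset_card_le _).trans
      ((Polynomial.card_roots' _).trans (by simp [Matrix.charpoly_natDegree_eq_dim]))
  obtain ⟨⟨Z, L⟩, ⟨hq, hqX⟩, hmin⟩ :=
    (measure fun q : Mat N × Mat N => N - q.1.charpoly.roots.toFinset.card).wf.has_min
      (O ∩ XN N) ⟨p, hp, hpX⟩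
  have hmax : IsMaxSpectrum O (Z, L) := ⟨hq, hqX, fun r hr hrX => by
    have h1 : ¬ (N - r.1.charpoly.roots.toFinset.card < N - Z.charpoly.roots.toFinset.card) :=
      hmin r ⟨hr, hrX⟩
    have h2 := hle r.1
    have h3 := hle Z
    change r.1.charpoly.roots.toFinset.card ≤ Z.charpoly.roots.toFinset.card
    omega⟩
  choose φ hφ using exists_isSpectralPoly Z
  refine ⟨(Z, L), hq, hqX, ?_⟩
  have hsum := sum_trace_spectralPoly hφ
  have hone : ∀ ξ ∈ Z.charpoly.roots.toFinset, (Polynomial.aeval Z (φ ξ)).trace = 1 :=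
    fun ξ hξ => mul_left_cancel₀ ((hφ ξ).trace_ne_zero hξ)
      ((hmax.trace_projector hO (hφ ξ)).trans (mul_one _).symm)
  rw [Finset.sum_congr rfl hone, Finset.sum_const, nsmul_eq_mul, mul_one] at hsum
  exact (Nat.cast_injective hsum).ge

end Density

section Continuity
variable {α : Type*} [TopologicalSpace α]

/-- A family of polynomials in two variables with continuous coefficients. -/
def HasContinuousCoeffs (f : α → Polynomial (Polynomial ℂ)) : Prop :=
  ∀ a b, Continuous fun x => ((f x).coeff a).coeff b

lemma hasContinuousCoeffs_const (q : Polynomial (Polynomial ℂ)) :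
    HasContinuousCoeffs fun _ : α => q := fun _ _ => continuous_const

lemma hasContinuousCoeffs_C {f : α → ℂ} (hf : Continuous f) :
    HasContinuousCoeffs fun x => Polynomial.C (Polynomial.C (f x)) := fun a b => by
  rcases eq_or_ne a 0 with rfl | ha
  · rcases eq_or_ne b 0 with rfl | hb
    · simpa using hf
    · simpa [Polynomial.coeff_C, hb] using continuous_const
  · simpa [Polynomial.coeff_C, ha] using continuous_const

lemma HasContinuousCoeffs.sub {f g : α → Polynomial (Polynomial ℂ)}
    (hf : HasContinuousCoeffs f) (hg : HasContinuousCoeffs g) :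
    HasContinuousCoeffs fun x => f x - g x := fun a b => by
  simp only [Polynomial.coeff_sub]
  exact (hf a b).sub (hg a b)

lemma HasContinuousCoeffs.mul {f g : α → Polynomial (Polynomial ℂ)}
    (hf : HasContinuousCoeffs f) (hg : HasContinuousCoeffs g) :
    HasContinuousCoeffs fun x => f x * g x := fun a b => by
  simp only [Polynomial.coeff_mul, Polynomial.finsetSum_coeff]
  exact continuous_finsetSum _ fun _ _ => continuous_finsetSum _ fun _ _ =>
    (hf _ _).mul (hg _ _)

lemma HasContinuousCoeffs.sum {ι : Type*} (s : Finset ι)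
    {f : ι → α → Polynomial (Polynomial ℂ)} (hf : ∀ i, HasContinuousCoeffs (f i)) :
    HasContinuousCoeffs fun x => ∑ i ∈ s, f i x := fun a b => by
  simp only [Polynomial.finsetSum_coeff]
  exact continuous_finsetSum _ fun i _ => hf i a b

lemma HasContinuousCoeffs.prod {ι : Type*} (s : Finset ι)
    {f : ι → α → Polynomial (Polynomial ℂ)} (hf : ∀ i, HasContinuousCoeffs (f i)) :
    HasContinuousCoeffs fun x => ∏ i ∈ s, f i x := by
  classical
  induction s using Finset.induction_on with
  | empty => simpa using hasContinuousCoeffs_const (α := α) 1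
  | insert i s hi ih => simpa only [Finset.prod_insert hi] using (hf i).mul ih

lemma hasContinuousCoeffs_cmPoly (N : ℕ) :
    HasContinuousCoeffs fun p : Mat N × Mat N => cmPoly p.1 p.2 := by
  have hfst : ∀ i j, Continuous fun p : Mat N × Mat N => p.1 i j := fun i j => by fun_prop
  have hsnd : ∀ i j, Continuous fun p : Mat N × Mat N => p.2 i j := fun i j => by fun_prop
  simp only [cmPoly, Matrix.det_apply', Matrix.sub_apply, Matrix.mul_apply, Matrix.map_apply]
  refine .sum _ fun σ => (hasContinuousCoeffs_const _).mul <| .prod _ fun i =>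
    .sub (.sum _ fun k => .mul ?_ ?_) (hasContinuousCoeffs_const _)
  · exact (hasContinuousCoeffs_const _).sub (hasContinuousCoeffs_C (hsnd _ _))
  · exact (hasContinuousCoeffs_const _).sub (hasContinuousCoeffs_C (hfst _ _))

lemma continuous_mcoeff {N : ℕ} (i j : Fin (N + 1)) :
    Continuous fun p : Mat N × Mat N => mcoeff N i j p.1 p.2 :=
  hasContinuousCoeffs_cmPoly N _ _

end Continuity

section Main
variable {N : ℕ} {bb : Fin (N + 1) → Fin (N + 1) → Module.End ℂ (V1 N)}

/-- A polynomial in the `m_ij` vanishing at all pairs `(diag x, cmLax x p 1)` vanishes on all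
of `X_N`. -/
lemma eval_mcoeff_eq_zero {R : MvPolynomial (Fin (N + 1) × Fin (N + 1)) ℂ}
    (h : ∀ x : Fin N → ℂ, Function.Injective x → ∀ p : Fin N → ℂ,
      MvPolynomial.eval (fun ij => mcoeff N ij.1 ij.2 (Matrix.diagonal x) (cmLax x p 1)) R = 0)
    (q : Mat N × Mat N) (hq : q ∈ XN N) :
    MvPolynomial.eval (fun ij => mcoeff N ij.1 ij.2 q.1 q.2) R = 0 := by
  by_contra hne
  have hcont : Continuous fun q : Mat N × Mat N =>
      MvPolynomial.eval (fun ij => mcoeff N ij.1 ij.2 q.1 q.2) R :=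
    (MvPolynomial.continuous_eval R).comp (continuous_pi fun ij => continuous_mcoeff ij.1 ij.2)
  obtain ⟨⟨Z, L⟩, hr, hrX, hcard⟩ :=
    exists_simple_spectrum_mem (isOpen_ne.preimage hcont) (p := q) hne hq
  obtain ⟨x, hx, p, U, U', hU, rfl, rfl⟩ := exists_conj_cmLax hrX hcard
  refine hr ?_
  simpa only [mcoeff_conj hU] using h x hx p

lemma substB_eq_zero_iff (hN : 0 < N)
    (hb : ∀ u v : ℂ, PB N u v =
      ∑ i : Fin (N + 1), ∑ j : Fin (N + 1),
        (u ^ (N - (i : ℕ)) * v ^ (N - (j : ℕ))) • bb i j)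
    (R : MvPolynomial (Fin (N + 1) × Fin (N + 1)) ℂ) :
    (∀ p ∈ XN N, MvPolynomial.eval (fun ij => mcoeff N ij.1 ij.2 p.1 p.2) R = 0) ↔
      substB N bb R = 0 := by
  have key : ∀ x (hx : Function.Injective x) p F, bethePsi hx p (substB N bb R F) =
      MvPolynomial.eval (fun ij => mcoeff N ij.1 ij.2 (Matrix.diagonal x) (cmLax x p 1)) R •
        bethePsi hx p F := fun x hx p F =>
    substB_apply_of_intertwine (bethePsi hx p) (fun i j F => bethePsi_coeff hx p hb i j F) R F
  refine ⟨fun h => LinearMap.ext fun F => eq_zero_of_bethePsi_eq_zero _ fun x hx p => ?_,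
    fun h => eval_mcoeff_eq_zero fun x hx p => ?_⟩
  · rw [key, h _ (diagonal_cmLax_mem_XN hN hx p), zero_smul]
  · have := key x hx p (Pi.single 1 1)
    rw [h, LinearMap.zero_apply, map_zero] at this
    exact (smul_eq_zero.1 this.symm).resolve_right (bethePsi_single_one_ne_zero hx p)

lemma commute_of_expansion
    (hb : ∀ u v : ℂ, PB N u v =
      ∑ i : Fin (N + 1), ∑ j : Fin (N + 1),
        (u ^ (N - (i : ℕ)) * v ^ (N - (j : ℕ))) • bb i j) (i j k l : Fin (N + 1)) :
    Commute (bb i j) (bb k l) :=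
  LinearMap.ext fun F => sub_eq_zero.1 <| eq_zero_of_bethePsi_eq_zero _ fun x hx p => by
    rw [map_sub, Module.End.mul_apply, Module.End.mul_apply]
    simp only [bethePsi_coeff hx p hb]
    rw [smul_comm, sub_self]

/-- Evaluation of polynomials at commuting operators agrees with `substB`. -/
lemma algHom_eq_substB
    (hb : ∀ u v : ℂ, PB N u v =
      ∑ i : Fin (N + 1), ∑ j : Fin (N + 1),
        (u ^ (N - (i : ℕ)) * v ^ (N - (j : ℕ))) • bb i j)
    {f : MvPolynomial (Fin (N + 1) × Fin (N + 1)) ℂ →ₐ[ℂ] Module.End ℂ (V1 N)}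
    (hf : ∀ ij, f (X ij) = bb ij.1 ij.2) (R : MvPolynomial (Fin (N + 1) × Fin (N + 1)) ℂ) :
    f R = substB N bb R := by
  refine LinearMap.ext fun F => sub_eq_zero.1 <| eq_zero_of_bethePsi_eq_zero _ fun x hx p => ?_
  rw [map_sub, substB_apply_of_intertwine (bethePsi hx p)
    (m := fun ij => mcoeff N ij.1 ij.2 (Matrix.diagonal x) (cmLax x p 1))
    (fun i j F => bethePsi_coeff hx p hb i j F), sub_eq_zero]
  induction R using MvPolynomial.induction_on generalizing F with
  | C a =>
    rw [← MvPolynomial.algebraMap_eq, AlgHom.commutes, MvPolynomial.algebraMap_eq,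
      MvPolynomial.eval_C, Module.algebraMap_end_apply, map_smul]
  | add R S hR hS => rw [map_add, LinearMap.add_apply, map_add, hR, hS, map_add, add_smul]
  | mul_X R ij hR =>
    rw [map_mul, Module.End.mul_apply, hR, hf, bethePsi_coeff hx p hb, map_mul,
      MvPolynomial.eval_X, smul_smul]

lemma adjoin_eq_range {A : Type*} [Ring A] [Algebra ℂ A] {ι : Type*}
    (f : MvPolynomial (ι × ι) ℂ →ₐ[ℂ] A) {a : ι → ι → A} (hf : ∀ ij, f (X ij) = a ij.1 ij.2) :
    Algebra.adjoin ℂ {x : A | ∃ i j, x = a i j} = f.range := by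
  rw [← Algebra.map_top, ← MvPolynomial.adjoin_range_X, AlgHom.map_adjoin, ← Set.range_comp]
  congr 1
  ext x
  simp only [Set.mem_ofPred_eq, Set.mem_range, Function.comp_apply, hf, Prod.exists, eq_comm]

/-- Two algebra homomorphisms out of the same ring with equal kernels have isomorphic ranges. -/
lemma exists_algEquiv_range {P A B : Type*} [CommRing P] [Algebra ℂ P] [Ring A] [Algebra ℂ A]
    [Ring B] [Algebra ℂ B] (f : P →ₐ[ℂ] A) (g : P →ₐ[ℂ] B) (h : ∀ r, f r = 0 ↔ g r = 0) :
    ∃ e : f.range ≃ₐ[ℂ] g.range, ∀ r, e (f.rangeRestrict r) = g.rangeRestrict r := by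
  have hk : RingHom.ker f.rangeRestrict = RingHom.ker g.rangeRestrict := by
    ext r
    simpa only [AlgHom.ker_rangeRestrict, RingHom.mem_ker] using h r
  let e₁ := Ideal.quotientKerAlgEquivOfSurjective f.rangeRestrict_surjective
  let e₂ := Ideal.quotientKerAlgEquivOfSurjective g.rangeRestrict_surjective
  refine ⟨(e₁.symm.trans (Ideal.quotientEquivAlgOfEq ℂ hk)).trans e₂, fun r => ?_⟩
  have : e₁.symm (f.rangeRestrict r) = Ideal.Quotient.mk _ r := by
    rw [AlgEquiv.symm_apply_eq]
    rfl
  simp only [AlgEquiv.trans_apply, this]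
  rfl

lemma exists_algEquiv_adjoin {A B : Type*} [Ring A] [Algebra ℂ A] [Ring B] [Algebra ℂ B]
    {ι : Type*} (f : MvPolynomial (ι × ι) ℂ →ₐ[ℂ] A) (g : MvPolynomial (ι × ι) ℂ →ₐ[ℂ] B)
    {a : ι → ι → A} {b : ι → ι → B} (hf : ∀ ij, f (X ij) = a ij.1 ij.2)
    (hg : ∀ ij, g (X ij) = b ij.1 ij.2) (h : ∀ r, f r = 0 ↔ g r = 0) :
    ∃ φ : Algebra.adjoin ℂ {x : A | ∃ i j, x = a i j} ≃ₐ[ℂ]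
        Algebra.adjoin ℂ {y : B | ∃ i j, y = b i j},
      ∀ i j, (φ ⟨a i j, Algebra.subset_adjoin ⟨i, j, rfl⟩⟩ : B) = b i j := by
  obtain ⟨e, he⟩ := exists_algEquiv_range f g h
  refine ⟨((Subalgebra.equivOfEq _ _ (adjoin_eq_range f hf)).trans e).trans
    (Subalgebra.equivOfEq _ _ (adjoin_eq_range g hg)).symm, fun i j => ?_⟩
  have h1 : Subalgebra.equivOfEq _ _ (adjoin_eq_range f hf)
      ⟨a i j, Algebra.subset_adjoin ⟨i, j, rfl⟩⟩ = f.rangeRestrict (X (i, j)) :=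
    Subtype.ext (hf (i, j)).symm
  rw [AlgEquiv.trans_apply, AlgEquiv.trans_apply, h1, he]
  exact hg (i, j)

end Main

set_option synthInstance.maxHeartbeats 1000000 in
/-- A polynomial in the `m_ij` vanishes identically on `X_N` iff the corresponding
polynomial in the `b̄_ij` vanishes in `End_ℂ(V_1)`; consequently `m_ij ↦ b̄_ij`
defines an isomorphism from the algebra of regular functions on the Calogero–Moser
space onto the Bethe algebra. -/
theorem stmt14 (N : ℕ) (hN : 0 < N)
    (bb : Fin (N + 1) → Fin (N + 1) → Module.End ℂ (V1 N))
    (hb : ∀ u v : ℂ, PB N u v =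
      ∑ i : Fin (N + 1), ∑ j : Fin (N + 1),
        (u ^ (N - (i : ℕ)) * v ^ (N - (j : ℕ))) • bb i j) :
    (∀ Rp : MvPolynomial (Fin (N + 1) × Fin (N + 1)) ℂ,
      ((∀ p ∈ XN N, MvPolynomial.eval (fun ij => mcoeff N ij.1 ij.2 p.1 p.2) Rp = 0) ↔
        substB N bb Rp = 0)) ∧
    ∃ φ : (Algebra.adjoin ℂ
            {h : XN N → ℂ | ∃ i j : Fin (N + 1),
              h = fun p : XN N => mcoeff N i j p.val.1 p.val.2}) ≃ₐ[ℂ]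
          (Algebra.adjoin ℂ
            {x : Module.End ℂ (V1 N) | ∃ i j : Fin (N + 1), x = bb i j}),
      ∀ i j : Fin (N + 1),
        (↑(φ ⟨fun p : XN N => mcoeff N i j p.val.1 p.val.2,
              Algebra.subset_adjoin ⟨i, j, rfl⟩⟩) : Module.End ℂ (V1 N)) = bb i j := by
  refine ⟨substB_eq_zero_iff hN hb, ?_⟩
  obtain ⟨g, hg⟩ := exists_algHom_of_commute
    (fun ij : Fin (N + 1) × Fin (N + 1) => bb ij.1 ij.2)
    (fun ij kl => commute_of_expansion hb ij.1 ij.2 kl.1 kl.2)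
  let f : MvPolynomial (Fin (N + 1) × Fin (N + 1)) ℂ →ₐ[ℂ] (XN N → ℂ) :=
    MvPolynomial.aeval fun ij p => mcoeff N ij.1 ij.2 p.val.1 p.val.2
  have hf : ∀ ij, f (X ij) = fun p => mcoeff N ij.1 ij.2 p.val.1 p.val.2 :=
    fun ij => MvPolynomial.aeval_X _ _
  have hf' : ∀ R p, f R p = MvPolynomial.eval
      (fun ij => mcoeff N ij.1 ij.2 p.val.1 p.val.2) R := fun R p => by
    induction R using MvPolynomial.induction_on with
    | C a => rw [← MvPolynomial.algebraMap_eq, AlgHom.commutes, MvPolynomial.algebraMap_eq,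
        MvPolynomial.eval_C]; rfl
    | add R S hR hS => rw [map_add, map_add, Pi.add_apply, hR, hS]
    | mul_X R ij hR => rw [map_mul, map_mul, Pi.mul_apply, hR, hf, MvPolynomial.eval_X]
  have hker : ∀ R, f R = 0 ↔ g R = 0 := fun R => by
    rw [algHom_eq_substB hb hg, ← substB_eq_zero_iff hN hb]
    refine ⟨fun h p hp => ?_, fun h => funext fun p => ?_⟩
    · rw [← hf' R ⟨p, hp⟩, h, Pi.zero_apply]
    · rw [hf' R p, Pi.zero_apply, h p.val p.property]
  exact exists_algEquiv_adjoin f g hf hg hker
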